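/- arXiv:2006.08308 — 2 statements merged into one kernel-verified Lean document; each statement's English description precedes it below -/
import Mathlib

section
/- Let 𝓕 be a family of entire functions, w₀ ∈ J(𝓕), and let f be an entire function such that the equation f(z) = w₀ has infinitely many simple roots. Then there exist a sequence {wₙ} with wₙ → w₀ and a sequence {fₙ} ⊆ 𝓕 such that each wₙ is a repelling fixed point of f ∘ fₙ. -/
open Filter Topology

/-- A sequence of complex functions tends to `∞` locally uniformly on `U`:
on every compact subset of `U` the moduli eventually exceed any bound,
uniformly. -/
def TendstoInftyLocallyUniformlyOn (F : ℕ → ℂ → ℂ) (U : Set ℂ) : Prop :=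
  ∀ M : ℝ, ∀ K ⊆ U, IsCompact K → ∀ᶠ n in atTop, ∀ z ∈ K, M ≤ ‖F n z‖

/-- The family `𝓕` is normal at the point `z₀` of the domain `D`: there is a
neighborhood `U ⊆ D` of `z₀` on which every sequence in `𝓕` has a subsequence
converging locally uniformly either to a holomorphic function or to `∞`. -/
def IsNormalAt (𝓕 : Set (ℂ → ℂ)) (D : Set ℂ) (z₀ : ℂ) : Prop :=
  ∃ U : Set ℂ, IsOpen U ∧ z₀ ∈ U ∧ U ⊆ D ∧
    ∀ f : ℕ → ℂ → ℂ, (∀ n, f n ∈ 𝓕) →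
      ∃ φ : ℕ → ℕ, StrictMono φ ∧
        ((∃ g : ℂ → ℂ, DifferentiableOn ℂ g U ∧
            TendstoLocallyUniformlyOn (fun n => f (φ n)) g atTop U) ∨
          TendstoInftyLocallyUniformlyOn (fun n => f (φ n)) U)

/-- The Fatou like set of the family `𝓕` on the domain `D`. -/
def fatouLike (𝓕 : Set (ℂ → ℂ)) (D : Set ℂ) : Set ℂ :=
  {z ∈ D | IsNormalAt 𝓕 D z}

/-- The Julia like set of the family `𝓕` on the domain `D`. -/
def juliaLike (𝓕 : Set (ℂ → ℂ)) (D : Set ℂ) : Set ℂ :=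
  D \ fatouLike 𝓕 D

open Metric Set in
/-- **Montel's theorem** for uniformly bounded sequences. -/
theorem exists_subseq_tendstoLocallyUniformlyOn_of_bounded {U : Set ℂ} (hU : IsOpen U)
    {f : ℕ → ℂ → ℂ} (hf : ∀ n, DifferentiableOn ℂ (f n) U) {B : ℝ}
    (hB : ∀ n, ∀ z ∈ U, ‖f n z‖ ≤ B) :
    ∃ φ : ℕ → ℕ, StrictMono φ ∧ ∃ g : ℂ → ℂ, DifferentiableOn ℂ g U ∧
      TendstoLocallyUniformlyOn (fun n => f (φ n)) g atTop U := by
  have hr : ∀ x : U, ∃ r > 0, ball (x : ℂ) r ⊆ U := fun x => isOpen_iff.1 hU x x.2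
  choose r hr0 hrU using hr
  let T : Set (U → ℂ) := {F | (∀ x, ‖F x‖ ≤ B) ∧
    ∀ x y : U, dist (y : ℂ) x < r x → dist (F y) (F x) ≤ 2 * B / r x * dist (y : ℂ) x}
  have hTcont : ∀ F ∈ T, ∀ x, ∀ ε > 0, ∃ δ > 0, ∀ G ∈ T, ∀ y : U, dist y x < δ →
      dist (G y) (G x) < ε := by
    intro F hF x ε hε
    have hB0 : 0 ≤ B := (norm_nonneg _).trans (hF.1 x)
    refine ⟨min (r x) (ε / (2 * B / r x + 1)), lt_min (hr0 x) (by have := hr0 x; positivity), ?_⟩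
    intro G hG y hy
    have h1 := lt_of_lt_of_le hy (min_le_left _ _)
    have h2 := lt_of_lt_of_le hy (min_le_right _ _)
    have hpos : 0 < 2 * B / r x + 1 := by have := hr0 x; positivity
    rw [lt_div_iff₀ hpos] at h2
    have h3 := hG.2 x y h1
    have h4 : dist (y : ℂ) x = dist y x := rfl
    rw [h4] at h3
    nlinarith [dist_nonneg (x := y) (y := x)]
  have hTclosed : IsClosed T := by
    have : T = (⋂ x : U, {F : U → ℂ | ‖F x‖ ≤ B}) ∩ ⋂ x : U, ⋂ y : U,
      {F : U → ℂ | dist (y : ℂ) x < r x → dist (F y) (F x) ≤ 2 * B / r x * dist (y : ℂ) x} := by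
      ext F; simp [T]
    rw [this]
    refine (isClosed_iInter fun x => isClosed_le (by fun_prop) (by fun_prop)).inter
      (isClosed_iInter fun x => isClosed_iInter fun y => ?_)
    by_cases h : dist (y : ℂ) x < r x
    · simp only [h, true_imp_iff]
      exact isClosed_le (by fun_prop) (by fun_prop)
    · simp [h]
  have hTcomp : IsCompact T := by
    refine (isCompact_univ_pi fun _ : U => isCompact_closedBall (0 : ℂ) B).of_isClosed_subset
      hTclosed fun F hF x _ => ?_
    simpa using hF.1 x
  let S : Set C(U, ℂ) := {F | (F : U → ℂ) ∈ T}
  have hS : IsCompact S := by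
    apply ArzelaAscoli.isCompact_of_equicontinuous
    · convert hTcomp
      ext F
      constructor
      · rintro ⟨G, hG, rfl⟩
        exact hG
      · intro hF
        refine ⟨⟨F, ?_⟩, hF, rfl⟩
        rw [Metric.continuous_iff]
        intro x ε hε
        obtain ⟨δ, hδ, h⟩ := hTcont F hF x ε hε
        exact ⟨δ, hδ, h F hF⟩
    · intro x
      rw [Metric.equicontinuousAt_iff]
      intro ε hε
      rcases S.eq_empty_or_nonempty with h | ⟨F, hF⟩
      · exact ⟨1, one_pos, fun _ _ G => absurd G.2 (by simp [h])⟩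
      · obtain ⟨δ, hδ, h⟩ := hTcont F hF x ε hε
        exact ⟨δ, hδ, fun y hy G => by
          rw [dist_comm]; exact h G G.2 y hy⟩
  have : LocallyCompactSpace U := hU.locallyCompactSpace
  let F : ℕ → C(U, ℂ) := fun n => ⟨U.domRestrict (f n), (hf n).continuousOn.domRestrict⟩
  have hFS : ∀ n, F n ∈ S := by
    refine fun n => ⟨fun x => hB n x x.2, fun x y hxy => ?_⟩
    refine Complex.dist_le_div_mul_dist_of_mapsTo_ball ((hf n).mono (hrU x)) ?_ hxy
    intro z hz
    rw [mem_closedBall, dist_eq_norm]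
    refine (norm_sub_le _ _).trans ?_
    linarith [hB n z (hrU x hz), hB n x x.2]
  obtain ⟨G, -, φ, hφ, hG⟩ := hS.isSeqCompact hFS
  rw [ContinuousMap.tendsto_iff_tendstoLocallyUniformly] at hG
  classical
  let g : ℂ → ℂ := fun z => if h : z ∈ U then G ⟨z, h⟩ else 0
  have hg : TendstoLocallyUniformlyOn (fun n => f (φ n)) g atTop U := by
    rw [tendstoLocallyUniformlyOn_iff_tendstoLocallyUniformly_comp_coe]
    have h1 : g ∘ ((↑) : U → ℂ) = G := by ext x; simp [g]
    rw [h1]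
    simpa [F, Function.comp_def] using! hG
  exact ⟨φ, hφ, g, hg.differentiableOn (Eventually.of_forall fun n => hf _) hU, hg⟩

open Metric Set in
/-- **Hurwitz's theorem**: zeros of a locally uniform limit of holomorphic functions that is not
locally zero are limits of zeros. -/
theorem eventually_exists_zero_of_tendstoLocallyUniformlyOn {U : Set ℂ} (hU : IsOpen U)
    {f : ℕ → ℂ → ℂ} {g : ℂ → ℂ} (hf : ∀ᶠ n in atTop, DifferentiableOn ℂ (f n) U)
    (hfg : TendstoLocallyUniformlyOn f g atTop U) {z₀ : ℂ} (hz₀ : z₀ ∈ U) (h0 : g z₀ = 0)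
    (hne : ¬ ∀ᶠ z in 𝓝 z₀, g z = 0) {ε : ℝ} (hε : 0 < ε) :
    ∀ᶠ n in atTop, ∃ z ∈ ball z₀ ε ∩ U, f n z = 0 := by
  have hg := hfg.differentiableOn hf hU
  have hga : AnalyticAt ℂ g z₀ := hg.analyticAt (hU.mem_nhds hz₀)
  have hev := (hga.eventually_eq_zero_or_eventually_ne_zero).resolve_left hne
  obtain ⟨δ, hδ, hδ'⟩ := Metric.eventually_nhds_iff.1
    ((eventually_nhdsWithin_iff.1 hev).and (hU.mem_nhds hz₀))
  set r := min ε δ / 2 with hr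
  have hr0 : 0 < r := by positivity
  have hrε : r < ε := by have := min_le_left ε δ; linarith
  have hrδ : r < δ := by have := min_le_right ε δ; linarith
  have hsub : closedBall z₀ r ⊆ U := fun z hz => (hδ' (lt_of_le_of_lt hz hrδ)).2
  obtain ⟨m, hm, hm'⟩ : ∃ m > 0, ∀ z ∈ sphere z₀ r, m ≤ ‖g z‖ := by
    obtain ⟨w, hw, hw'⟩ := (isCompact_sphere z₀ r).exists_isMinOn
      (NormedSpace.sphere_nonempty.2 hr0.le)
      ((hg.continuousOn.mono (sphere_subset_closedBall.trans hsub)).norm)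
    refine ⟨‖g w‖, norm_pos_iff.2 ?_, fun z hz => hw' hz⟩
    refine (hδ' (lt_of_le_of_lt (sphere_subset_closedBall hw) hrδ)).1 ?_
    rintro rfl
    simp at hw
    exact hr0.ne hw
  have hunif := (tendstoLocallyUniformlyOn_iff_forall_isCompact hU).1 hfg _ hsub
    (isCompact_closedBall z₀ r)
  filter_upwards [Metric.tendstoUniformlyOn_iff.1 hunif (m / 2) (by positivity), hf] with n hn hfn
  by_contra! hcon
  have hnz : ∀ z ∈ closedBall z₀ r, f n z ≠ 0 := fun z hz =>
    hcon z ⟨lt_of_le_of_lt hz hrε, hsub hz⟩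
  have hd : DiffContOnCl ℂ (fun z => (f n z)⁻¹) (ball z₀ r) := by
    refine DifferentiableOn.diffContOnCl ?_
    rw [closure_ball _ hr0.ne']
    exact (hfn.mono hsub).inv hnz
  have hle := Complex.norm_le_of_forall_mem_frontier_norm_le isBounded_ball hd (C := 2 / m) (by
    intro z hz
    rw [frontier_ball _ hr0.ne'] at hz
    have h1 := hn z (sphere_subset_closedBall hz)
    rw [dist_eq_norm] at h1
    have h2 := hm' z hz
    have h3 := norm_sub_norm_le (g z) (f n z)
    rw [norm_inv, inv_le_comm₀ (norm_pos_iff.2 (hnz z (sphere_subset_closedBall hz)))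
      (by positivity), inv_div]
    linarith) (subset_closure (mem_ball_self hr0))
  have h1 := hn z₀ (mem_closedBall_self hr0.le)
  rw [h0, dist_zero_left] at h1
  have h2 := norm_pos_iff.2 (hnz z₀ (mem_closedBall_self hr0.le))
  rw [norm_inv, inv_le_comm₀ h2 (by positivity), inv_div] at hle
  linarith

open Metric Set in
/-- If `‖deriv f‖ ≤ M (1 + ‖f‖) ^ 2`, then `(1 + ‖f‖)⁻¹` is `M`-Lipschitz on convex sets; here in the form
of a comparison over distances less than `1 / (4 * M)`. -/
theorem norm_le_of_norm_deriv_le_sq {f : ℂ → ℂ} {s : Set ℂ} (hs : Convex ℝ s) (hso : IsOpen s)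
    {M p : ℝ} (hf : DifferentiableOn ℂ f s) (hM : ∀ z ∈ s, ‖deriv f z‖ ≤ M * (1 + ‖f z‖) ^ 2)
    {z w : ℂ} (hz : z ∈ s) (hw : w ∈ s) (hzw : M * ‖w - z‖ < 1 / 4) (hp : 1 / 4 < p)
    (hfz : ‖f z‖ ≤ p⁻¹ - 1) : ‖f w‖ ≤ (p - 1 / 4)⁻¹ - 1 := by
  set γ : ℝ → ℂ := fun t => z + t * (w - z) with hγ
  have hγs : ∀ t ∈ Icc (0 : ℝ) 1, γ t ∈ s := by
    intro t ht
    have := hs.add_smul_sub_mem hz hw ht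
    simpa [hγ] using this
  have hγd : ∀ t : ℝ, HasDerivAt γ (w - z) t := by
    intro t
    have := ((Complex.ofRealCLM.hasDerivAt (x := t)).mul_const (w - z)).const_add z
    simpa [hγ] using this
  have hpos : ∀ t ∈ Icc (0 : ℝ) 1, 0 < p - 1 / 4 * t := fun t ht => by linarith [ht.2]
  have hd : ∀ t ∈ Icc (0 : ℝ) 1, HasDerivAt (fun t => f (γ t)) (deriv f (γ t) * (w - z)) t := by
    intro t ht
    exact ((hf.differentiableAt (hso.mem_nhds (hγs t ht))).hasDerivAt).comp t (hγd t)
  have hB : ∀ t ∈ Icc (0 : ℝ) 1, HasDerivAt (fun t : ℝ => (p - 1 / 4 * t)⁻¹ - 1)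
      (1 / 4 * ((p - 1 / 4 * t)⁻¹) ^ 2) t := by
    intro t ht
    have h1 : HasDerivAt (fun t : ℝ => p - 1 / 4 * t) (-(1 / 4)) t := by
      simpa using ((hasDerivAt_id t).const_mul (1 / 4 : ℝ)).const_sub p
    refine ((h1.fun_inv (hpos t ht).ne').sub_const 1).congr_deriv ?_
    rw [neg_neg, inv_pow]; rfl
  have key := image_norm_le_of_norm_deriv_right_lt_deriv_boundary' (a := 0) (b := 1)
    (f := fun t => f (γ t)) (f' := fun t => deriv f (γ t) * (w - z))
    (B := fun t => (p - 1 / 4 * t)⁻¹ - 1) (B' := fun t => 1 / 4 * ((p - 1 / 4 * t)⁻¹) ^ 2)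
    (fun t ht => (hd t ht).continuousAt.continuousWithinAt)
    (fun t ht => (hd t ⟨ht.1, ht.2.le⟩).hasDerivWithinAt)
    (by simpa [hγ] using hfz)
    (fun t ht => (hB t ht).continuousAt.continuousWithinAt)
    (fun t ht => (hB t ⟨ht.1, ht.2.le⟩).hasDerivWithinAt)
    (by
      intro t ht hft
      have h1 := hM _ (hγs t ⟨ht.1, ht.2.le⟩)
      have h2 : 0 < (p - 1 / 4 * t)⁻¹ := inv_pos.2 (hpos t ⟨ht.1, ht.2.le⟩)
      rw [hft, add_sub_cancel] at h1
      rw [norm_mul]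
      calc _ ≤ M * (p - 1 / 4 * t)⁻¹ ^ 2 * ‖w - z‖ := by gcongr
        _ = M * ‖w - z‖ * (p - 1 / 4 * t)⁻¹ ^ 2 := by ring
        _ < _ := by gcongr)
  have := key (right_mem_Icc.2 zero_le_one)
  simpa [hγ] using this

open Metric Set in
/-- **Marty's criterion**, sufficiency. -/
theorem exists_subseq_of_norm_deriv_le_sq {c : ℂ} {r M : ℝ} (hM0 : 0 ≤ M) (hMr : M * r ≤ 1 / 4)
    {f : ℕ → ℂ → ℂ} (hf : ∀ n, DifferentiableOn ℂ (f n) (ball c r))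
    (hM : ∀ n, ∀ z ∈ ball c r, ‖deriv (f n) z‖ ≤ M * (1 + ‖f n z‖) ^ 2) :
    ∃ φ : ℕ → ℕ, StrictMono φ ∧
      ((∃ g : ℂ → ℂ, DifferentiableOn ℂ g (ball c r) ∧
          TendstoLocallyUniformlyOn (fun n => f (φ n)) g atTop (ball c r)) ∨
        TendstoInftyLocallyUniformlyOn (fun n => f (φ n)) (ball c r)) := by
  rcases le_or_gt r 0 with hr | hr
  · refine ⟨id, strictMono_id, Or.inl ⟨0, ?_⟩⟩
    rw [ball_eq_empty.2 hr]
    exact ⟨differentiableOn_empty, fun _ _ _ h => h.elim⟩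
  have hc : c ∈ ball c r := mem_ball_self hr
  have hdist : ∀ z ∈ ball c r, M * ‖z - c‖ < 1 / 4 := by
    intro z hz
    rw [mem_ball, dist_eq_norm] at hz
    rcases hM0.eq_or_lt with h | h
    · rw [← h]; norm_num
    · exact (mul_lt_mul_of_pos_left hz h).trans_le hMr
  by_cases hbdd : ∃ᶠ n in atTop, ‖f n c‖ ≤ 1
  · obtain ⟨φ, hφ, h⟩ := extraction_of_frequently_atTop hbdd
    obtain ⟨ψ, hψ, g, hg, hconv⟩ := exists_subseq_tendstoLocallyUniformlyOn_of_bounded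
      (f := fun n => f (φ n)) (B := 3) isOpen_ball (fun n => hf _) (fun n z hz => by
        have := norm_le_of_norm_deriv_le_sq (convex_ball c r) isOpen_ball (hf (φ n)) (hM (φ n))
          hc hz (hdist z hz) (p := 1 / 2) (by norm_num) (by have := h n; norm_num; linarith)
        norm_num at this
        exact this)
    exact ⟨φ ∘ ψ, hφ.comp hψ, Or.inl ⟨g, hg, hconv⟩⟩
  · rw [not_frequently] at hbdd
    obtain ⟨φ, hφ, h⟩ := extraction_of_eventually_atTop hbdd
    have hlow : ∀ n, ∀ z ∈ ball c r, 1 / 3 ≤ ‖f (φ n) z‖ := by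
      intro n z hz
      by_contra! hlt
      have := norm_le_of_norm_deriv_le_sq (convex_ball c r) isOpen_ball (hf (φ n)) (hM (φ n))
          hz hc (by rw [norm_sub_rev]; exact hdist z hz) (p := 3 / 4) (by norm_num)
          (by norm_num; linarith)
      norm_num at this
      exact h n this
    have hne : ∀ n, ∀ z ∈ ball c r, f (φ n) z ≠ 0 := fun n z hz h0 => by
      have := hlow n z hz
      rw [h0, norm_zero] at this
      norm_num at this
    have hinv : ∀ n, DifferentiableOn ℂ (fun z => (f (φ n) z)⁻¹) (ball c r) :=
      fun n => (hf _).inv (hne n)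
    obtain ⟨ψ, hψ, G, hG, hconv⟩ := exists_subseq_tendstoLocallyUniformlyOn_of_bounded
      (f := fun n z => (f (φ n) z)⁻¹) (B := 3) isOpen_ball hinv
      (fun n z hz => by
        rw [norm_inv, inv_le_comm₀ (norm_pos_iff.2 (hne n z hz)) (by norm_num)]
        linarith [hlow n z hz])
    refine ⟨φ ∘ ψ, hφ.comp hψ, ?_⟩
    by_cases hz : ∃ z ∈ ball c r, G z = 0
    · right
      obtain ⟨z₀, hz₀, hGz⟩ := hz
      have hloc : ∀ᶠ z in 𝓝 z₀, G z = 0 := by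
        by_contra hcon
        obtain ⟨n, z, hz, h0⟩ := (eventually_exists_zero_of_tendstoLocallyUniformlyOn isOpen_ball
          (Eventually.of_forall fun n => hinv (ψ n)) hconv hz₀ hGz hcon one_pos).exists
        exact hne _ z hz.2 (inv_eq_zero.1 h0)
      have hG0 := (hG.analyticOnNhd isOpen_ball).eqOn_zero_of_preconnected_of_eventuallyEq_zero
        (convex_ball c r).isPreconnected hz₀ hloc
      intro L K hKU hK
      have hu := (tendstoLocallyUniformlyOn_iff_forall_isCompact isOpen_ball).1 hconv K hKU hK
      filter_upwards [Metric.tendstoUniformlyOn_iff.1 hu (|L| + 1)⁻¹ (by positivity)] with n hn z hz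
      have h1 := hn z hz
      rw [hG0 (hKU hz), Pi.zero_apply, dist_zero_left, norm_inv,
        inv_lt_inv₀ (norm_pos_iff.2 (hne _ z (hKU hz))) (by positivity)] at h1
      have : L ≤ |L| := le_abs_self L
      change L ≤ ‖f (φ (ψ n)) z‖
      linarith
    · left
      push Not at hz
      refine ⟨fun z => (G z)⁻¹, hG.inv hz, ?_⟩
      have := hconv.inv₀ hG.continuousOn hz
      simpa [Function.comp_def, Pi.inv_def] using this

open Metric Set in
theorem exists_norm_le_of_norm_deriv_le_sq (B : ℝ) : ∃ B' : ℝ, ∀ h : ℂ → ℂ,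
    DifferentiableOn ℂ h (ball 0 (1 / 8)) →
    (∀ z ∈ ball (0 : ℂ) (1 / 8), ‖deriv h z‖ ≤ 2 * (1 + ‖h z‖) ^ 2) → ‖h 0‖ ≤ B →
    ∀ z ∈ closedBall (0 : ℂ) (1 / 16), ‖h z‖ ≤ B' := by
  by_contra! hcon
  choose h hd hM hB z hz hlt using fun n : ℕ => hcon n
  have hsub : closedBall (0 : ℂ) (1 / 16) ⊆ ball 0 (1 / 8) :=
    closedBall_subset_ball (by norm_num)
  obtain ⟨φ, hφ, ⟨g, hg, hconv⟩ | hinf⟩ :=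
    exists_subseq_of_norm_deriv_le_sq (c := 0) (r := 1 / 8) (M := 2) (by norm_num) (by norm_num)
      hd hM
  · obtain ⟨C, hC⟩ := (isCompact_closedBall (0 : ℂ) (1 / 16)).exists_bound_of_continuousOn
      (hg.continuousOn.mono hsub)
    have hu := (tendstoLocallyUniformlyOn_iff_forall_isCompact isOpen_ball).1 hconv _ hsub
      (isCompact_closedBall _ _)
    obtain ⟨n, hn, hnC⟩ := ((Metric.tendstoUniformlyOn_iff.1 hu 1 one_pos).and
      (tendsto_natCast_atTop_atTop.eventually_ge_atTop (C + 1))).exists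
    have h1 := hn _ (hz (φ n))
    have h2 := hC _ (hz (φ n))
    have h3 := hlt (φ n)
    have h4 : (n : ℝ) ≤ φ n := by exact_mod_cast hφ.id_le n
    rw [dist_eq_norm, norm_sub_rev] at h1
    have h5 := norm_sub_norm_le (h (φ n) (z (φ n))) (g (z (φ n)))
    linarith
  · obtain ⟨n, hn⟩ := (hinf (B + 1) {0} (by simp) isCompact_singleton).exists
    have h1 := hn 0 rfl
    have h2 := hB (φ n)
    linarith

open Metric Set in
theorem exists_norm_le_closedBall_of_norm_deriv_le_sq (B : ℝ) (m : ℕ) : ∃ B' : ℝ, ∀ h : ℂ → ℂ,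
    DifferentiableOn ℂ h (ball 0 (m / 16 + 1 / 8)) →
    (∀ z ∈ ball (0 : ℂ) (m / 16 + 1 / 8), ‖deriv h z‖ ≤ 2 * (1 + ‖h z‖) ^ 2) → ‖h 0‖ ≤ B →
    ∀ z ∈ closedBall (0 : ℂ) (m / 16), ‖h z‖ ≤ B' := by
  induction m with
  | zero =>
    refine ⟨B, fun h _ _ hB z hz => ?_⟩
    have : z = 0 := by simpa using hz
    rwa [this]
  | succ m ih =>
    obtain ⟨B₁, hB₁⟩ := ih
    obtain ⟨B₂, hB₂⟩ := exists_norm_le_of_norm_deriv_le_sq B₁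
    refine ⟨B₂, fun h hd hM hB z hz => ?_⟩
    rw [mem_closedBall_zero_iff] at hz
    push_cast at hz hd hM
    have hle : ball (0 : ℂ) (m / 16 + 1 / 8) ⊆ ball 0 ((m + 1) / 16 + 1 / 8) :=
      ball_subset_ball (by linarith)
    have hm : (0 : ℝ) < m + 1 := by positivity
    set c : ℂ := ((m / (m + 1) : ℝ) : ℂ) * z with hc
    have hcn : ‖c‖ ≤ m / 16 := by
      rw [hc, norm_mul, Complex.norm_real, Real.norm_of_nonneg (by positivity),
        div_mul_eq_mul_div, div_le_iff₀ hm]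
      calc (m : ℝ) * ‖z‖ ≤ m * ((m + 1) / 16) := by gcongr
        _ = _ := by ring
    have hzc : ‖z - c‖ ≤ 1 / 16 := by
      have : z - c = ((1 / (m + 1) : ℝ) : ℂ) * z := by
        have : ((m : ℂ) + 1) ≠ 0 := by exact_mod_cast hm.ne'
        rw [hc]; push_cast; field_simp; ring
      rw [this, norm_mul, Complex.norm_real, Real.norm_of_nonneg (by positivity),
        div_mul_eq_mul_div, div_le_iff₀ hm]
      linarith
    have hc0 := hB₁ h (hd.mono hle) (fun w hw => hM w (hle hw)) hB c
      (mem_closedBall_zero_iff.2 hcn)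
    have hmaps : ∀ w ∈ ball (0 : ℂ) (1 / 8), c + w ∈ ball (0 : ℂ) ((m + 1) / 16 + 1 / 8) := by
      intro w hw
      rw [mem_ball_zero_iff] at hw ⊢
      have := norm_add_le c w
      linarith
    have := hB₂ (fun w => h (c + w))
      (hd.comp (by fun_prop) hmaps)
      (fun w hw => by
        rw [deriv_comp_const_add]
        exact hM _ (hmaps w hw)) (by simpa using hc0) (z - c)
      (mem_closedBall_zero_iff.2 hzc)
    simpa using this

open Metric Set in
theorem exists_norm_le_of_norm_deriv_eq_sq : ∃ B : ℝ, ∀ h : ℂ → ℂ,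
    DifferentiableOn ℂ h (ball 0 (1 / 8)) →
    (∀ z ∈ ball (0 : ℂ) (1 / 8), ‖deriv h z‖ ≤ 2 * (1 + ‖h z‖) ^ 2) →
    ‖deriv h 0‖ = (1 + ‖h 0‖) ^ 2 → ‖h 0‖ ≤ B := by
  by_contra! hcon
  choose h hd hM heq hlt using fun n : ℕ => hcon n
  have hsub : closedBall (0 : ℂ) (1 / 16) ⊆ ball 0 (1 / 8) :=
    closedBall_subset_ball (by norm_num)
  obtain ⟨φ, hφ, ⟨g, hg, hconv⟩ | hinf⟩ :=
    exists_subseq_of_norm_deriv_le_sq (c := 0) (r := 1 / 8) (M := 2) (by norm_num) (by norm_num)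
      hd hM
  · have h0 : (0 : ℂ) ∈ ball (0 : ℂ) (1 / 8) := by simp
    have ht := (hconv.tendsto_at h0).norm
    obtain ⟨n, hn, hnC⟩ := ((ht.eventually_lt_const (lt_add_one _)).and
      (tendsto_natCast_atTop_atTop.eventually_ge_atTop (‖g 0‖ + 1))).exists
    have h3 := hlt (φ n)
    have h4 : (n : ℝ) ≤ φ n := by exact_mod_cast hφ.id_le n
    linarith
  · obtain ⟨n, hn⟩ := (hinf 64 _ hsub (isCompact_closedBall _ _)).exists
    have hle : ∀ z ∈ ball (0 : ℂ) (1 / 16), 64 ≤ ‖h (φ n) z‖ :=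
      fun z hz => hn z (ball_subset_closedBall hz)
    have h0 : (0 : ℂ) ∈ ball (0 : ℂ) (1 / 16) := by simp
    have hne : ∀ z ∈ ball (0 : ℂ) (1 / 16), h (φ n) z ≠ 0 := fun z hz =>
      norm_pos_iff.1 (by linarith [hle z hz])
    have hd' := (hd (φ n)).mono (ball_subset_closedBall.trans hsub)
    have hinv : ∀ z ∈ ball (0 : ℂ) (1 / 16), ‖(h (φ n) z)⁻¹‖ ≤ 1 / 64 := fun z hz => by
      rw [norm_inv, inv_le_comm₀ (norm_pos_iff.2 (hne z hz)) (by norm_num)]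
      linarith [hle z hz]
    have key := Complex.norm_deriv_le_div_of_mapsTo_ball (f := fun z => (h (φ n) z)⁻¹) (c := 0)
      (R₁ := 1 / 16) (R₂ := 1 / 32) (hd'.inv hne) (fun z hz => by
        rw [mem_closedBall, dist_eq_norm]
        refine (norm_sub_le _ _).trans ?_
        linarith [hinv z hz, hinv 0 h0]) (by norm_num)
    rw [deriv_fun_inv'' (hd'.differentiableAt (isOpen_ball.mem_nhds h0)) (hne 0 h0), norm_div,
      norm_neg, norm_pow, heq, div_le_iff₀ (by have := norm_pos_iff.2 (hne 0 h0); positivity)]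
      at key
    nlinarith [norm_nonneg (h (φ n) 0)]

open Metric Set in
/-- The rescaling step of **Zalcman's lemma**. -/
theorem exists_rescaling {f : ℂ → ℂ} (hf : Differentiable ℂ f) {c : ℂ} {r M : ℝ} (hr : 0 < r)
    (hM : 0 < M) (h : M * (1 + ‖f c‖) ^ 2 < ‖deriv f c‖) :
    ∃ z : ℂ, ∃ ρ : ℝ, 0 < ρ ∧ ρ * M ≤ 1 ∧
      ‖deriv (fun ζ : ℂ => f (z + ρ * ζ)) 0‖ = (1 + ‖f z‖) ^ 2 ∧
      ∀ ζ ∈ ball (0 : ℂ) (r * M / 2), z + ρ * ζ ∈ ball c r ∧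
        ‖deriv (fun ζ : ℂ => f (z + ρ * ζ)) ζ‖ ≤ 2 * (1 + ‖f (z + ρ * ζ)‖) ^ 2 := by
  set l : ℂ → ℝ := fun z => ‖deriv f z‖ / (1 + ‖f z‖) ^ 2 with hl
  have hpos : ∀ z, 0 < (1 + ‖f z‖) ^ 2 := fun z => by positivity
  have hlc : Continuous l := by
    have h1 : Continuous (deriv f) :=
      (hf.contDiff (n := 1)).continuous_deriv le_rfl
    exact h1.norm.div (by have := hf.continuous; fun_prop) fun z => (hpos z).ne'
  have hl0 : ∀ z, 0 ≤ l z := fun z => by positivity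
  obtain ⟨z, hz, hmax⟩ := (isCompact_closedBall c r).exists_isMaxOn
    (f := fun z => (r - ‖z - c‖) * l z) ⟨c, mem_closedBall_self hr.le⟩
    (by fun_prop)
  have hlM : M < l c := (lt_div_iff₀ (hpos c)).2 h
  have hzc : r * l c ≤ (r - ‖z - c‖) * l z := by
    simpa using hmax (mem_closedBall_self hr.le)
  rw [mem_closedBall, dist_eq_norm] at hz
  have hrl : r * M < (r - ‖z - c‖) * l z := (mul_lt_mul_of_pos_left hlM hr).trans_le hzc
  have hlz : 0 < l z := by
    rcases (hl0 z).eq_or_lt with h0 | h0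
    · rw [← h0] at hrl; nlinarith
    · exact h0
  have hd : 0 < r - ‖z - c‖ := by
    by_contra! hcon
    nlinarith
  have hMl : M < l z := by
    have : (r - ‖z - c‖) * l z ≤ r * l z := by
      have := norm_nonneg (z - c); gcongr; linarith
    exact lt_of_mul_lt_mul_left (hrl.trans_le this) hr.le
  have hder : ∀ ζ : ℂ, deriv (fun ζ : ℂ => f (z + ((l z)⁻¹ : ℝ) * ζ)) ζ =
      deriv f (z + ((l z)⁻¹ : ℝ) * ζ) * ((l z)⁻¹ : ℝ) := by
    intro ζ
    have h1 : HasDerivAt (fun ζ : ℂ => z + ((l z)⁻¹ : ℝ) * ζ) ((l z)⁻¹ : ℝ) ζ := by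
      simpa using ((hasDerivAt_id ζ).const_mul (((l z)⁻¹ : ℝ) : ℂ)).const_add z
    exact ((hf _).hasDerivAt.comp ζ h1).deriv
  refine ⟨z, (l z)⁻¹, inv_pos.2 hlz, ?_, ?_, ?_⟩
  · rw [inv_mul_le_iff₀ hlz]; linarith
  · rw [hder, norm_mul, Complex.norm_real, Real.norm_of_nonneg (inv_pos.2 hlz).le]
    simp only [mul_zero, add_zero]
    have : ‖deriv f z‖ = l z * (1 + ‖f z‖) ^ 2 := by
      rw [hl]; field_simp
    rw [this]
    field_simp
  · intro ζ hζ
    rw [mem_ball_zero_iff] at hζ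
    set w := z + ((l z)⁻¹ : ℝ) * ζ with hw
    have hwz : ‖w - z‖ ≤ (r - ‖z - c‖) / 2 := by
      rw [hw, add_sub_cancel_left, norm_mul, Complex.norm_real,
        Real.norm_of_nonneg (inv_pos.2 hlz).le, inv_mul_le_iff₀ hlz]
      linarith
    have hwc : ‖w - c‖ ≤ ‖w - z‖ + ‖z - c‖ := norm_sub_le_norm_sub_add_norm_sub _ _ _
    have hwr : ‖w - c‖ < r := by linarith
    refine ⟨by rwa [mem_ball, dist_eq_norm], ?_⟩
    have hmw : (r - ‖w - c‖) * l w ≤ (r - ‖z - c‖) * l z :=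
      hmax (by rw [mem_closedBall, dist_eq_norm]; exact hwr.le)
    have hlw : l w ≤ 2 * l z := by
      have : (r - ‖z - c‖) / 2 * l w ≤ (r - ‖w - c‖) * l w := by
        have := hl0 w
        gcongr
        linarith
      have h2 : (r - ‖z - c‖) * l w ≤ (r - ‖z - c‖) * (2 * l z) := by linarith
      exact le_of_mul_le_mul_left h2 hd
    rw [hder, norm_mul, Complex.norm_real, Real.norm_of_nonneg (inv_pos.2 hlz).le, ← hw]
    have : ‖deriv f w‖ = l w * (1 + ‖f w‖) ^ 2 := by
      rw [hl]; field_simp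
    rw [this, mul_inv_le_iff₀ hlz]
    nlinarith [hpos w]

/-- An analytic function is not strictly dominated, up to second order, by its value at a point. -/
theorem not_eventually_norm_mul_one_add_le {P : ℂ → ℂ} {z₀ : ℂ} (hP : AnalyticAt ℂ P z₀)
    (h0 : P z₀ ≠ 0) {A : ℝ} (hA : 0 < A) :
    ¬ ∀ᶠ z in 𝓝 z₀, ‖P z‖ * (1 + A * ‖z - z₀‖ ^ 2) ≤ ‖P z₀‖ := by
  intro h
  have hmax : IsLocalMax (norm ∘ P) z₀ := by
    filter_upwards [h] with z hz
    have : 0 ≤ ‖P z‖ * (A * ‖z - z₀‖ ^ 2) := by positivity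
    simp only [Function.comp]
    linarith
  have hc := Complex.eventually_eq_of_isLocalMax_norm
    (hP.eventually_analyticAt.mono fun z hz => hz.differentiableAt) hmax
  have hboth := (h.and hc).filter_mono (nhdsWithin_le_nhds (s := {z₀}ᶜ))
  obtain ⟨z, ⟨hz, hzc⟩, hne⟩ := (hboth.and self_mem_nhdsWithin).exists
  rw [hzc] at hz
  have h1 : 0 < ‖P z₀‖ := norm_pos_iff.2 h0
  have h2 : 0 < ‖z - z₀‖ := norm_pos_iff.2 (sub_ne_zero.2 hne)
  have : 0 < ‖P z₀‖ * (A * ‖z - z₀‖ ^ 2) := by positivity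
  linarith

theorem AnalyticAt.eventually_norm_sq_mul_one_add_le {v : ℂ → ℂ} {z₀ : ℂ} (hv : AnalyticAt ℂ v z₀)
    {k : ℝ} (hk : k * (1 + ‖v z₀‖ ^ 2) ^ 2 < ‖deriv v z₀‖ ^ 2) :
    ∃ H : ℂ → ℂ, AnalyticAt ℂ H z₀ ∧ ‖H z₀‖ ^ 2 = 1 + ‖v z₀‖ ^ 2 ∧
      ∀ᶠ z in 𝓝 z₀, ‖H z‖ ^ 2 * (1 + k * ‖z - z₀‖ ^ 2) ≤ 1 + ‖v z‖ ^ 2 := by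
  set x : ℝ := ‖v z₀‖ ^ 2 with hx
  have hx0 : 0 ≤ x := by positivity
  set T : ℝ := Real.sqrt (1 + x) with hT
  have hT2 : T ^ 2 = 1 + x := Real.sq_sqrt (by positivity)
  have hTpos : 0 < T := Real.sqrt_pos.2 (by positivity)
  set c : ℂ := (starRingEnd ℂ) (v z₀) with hc
  have hnH : ∀ z, ‖(1 + c * v z) / (T : ℂ)‖ ^ 2 = ‖1 + c * v z‖ ^ 2 / (1 + x) := by
    intro z
    rw [norm_div, div_pow, Complex.norm_real, Real.norm_of_nonneg hTpos.le, hT2]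
  have hid : ∀ z, (1 + ‖v z‖ ^ 2) * (1 + x) = ‖1 + c * v z‖ ^ 2 + ‖v z - v z₀‖ ^ 2 := by
    intro z
    rw [hx, ← Complex.normSq_eq_norm_sq, ← Complex.normSq_eq_norm_sq, ← Complex.normSq_eq_norm_sq,
      ← Complex.normSq_eq_norm_sq]
    simp [Complex.normSq_apply, hc]
    ring
  refine ⟨fun z => (1 + c * v z) / (T : ℂ), ?_, ?_, ?_⟩
  · exact (analyticAt_const.add (analyticAt_const.mul hv)).div analyticAt_const
      (by exact_mod_cast hTpos.ne')
  · have h1 := hid z₀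
    rw [sub_self, norm_zero] at h1
    have hxpos : (1 + x) ≠ 0 := by positivity
    simp only [hnH]
    rw [div_eq_iff hxpos]
    nlinarith [h1]
  · have hcont : ContinuousAt (dslope v z₀) z₀ :=
      continuousAt_dslope_same.2 hv.differentiableAt
    have hcl : ContinuousAt (fun z => k * ‖1 + c * v z‖ ^ 2) z₀ := by
      have := hv.continuousAt
      fun_prop
    have hlt : k * ‖1 + c * v z₀‖ ^ 2 < ‖dslope v z₀ z₀‖ ^ 2 := by
      have h1 := hid z₀
      rw [sub_self, norm_zero] at h1
      rw [dslope_same]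
      calc k * ‖1 + c * v z₀‖ ^ 2 = k * (1 + x) ^ 2 := by
            rw [show ‖1 + c * v z₀‖ ^ 2 = (1 + x) ^ 2 by nlinarith [h1]]
        _ < _ := hk
    filter_upwards [hcl.eventually_lt (hcont.norm.pow 2) hlt] with z hz
    have hs : v z - v z₀ = (z - z₀) * dslope v z₀ z := by
      rw [← smul_eq_mul, sub_smul_dslope]
    have hd : ‖v z - v z₀‖ ^ 2 = ‖z - z₀‖ ^ 2 * ‖dslope v z₀ z‖ ^ 2 := by
      rw [hs, norm_mul, mul_pow]
    have hxpos : 0 < 1 + x := by positivity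
    rw [hnH, div_mul_eq_mul_div, div_le_iff₀ hxpos, hid, hd]
    simp only [Pi.pow_apply] at hz
    have := mul_le_mul_of_nonneg_left hz.le (sq_nonneg ‖z - z₀‖)
    linarith

theorem one_add_le_one_add_mul_one_sub_pow {t : ℝ} (h0 : 0 ≤ t) (h1 : 32 * t ≤ 1) :
    1 + t ≤ (1 + 16 * t) * (1 - 2 * t) ^ 4 := by
  have h := one_add_mul_le_pow (a := -2 * t) (by linarith) 4
  have e : 1 + -2 * t = 1 - 2 * t := by ring
  rw [e] at h
  push_cast at h
  have h2 : (1 + 16 * t) * (1 - 8 * t) ≤ (1 + 16 * t) * (1 - 2 * t) ^ 4 := by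
    gcongr
    linarith
  nlinarith

theorem sq_norm_deriv_mul_le_of_eventually_le {Ψ v : ℂ → ℂ} {z₀ : ℂ} {R : ℝ}
    (hz₀ : ‖z₀‖ < R) (hΨ : AnalyticAt ℂ Ψ z₀) (hΨ0 : Ψ z₀ ≠ 0) (hv : AnalyticAt ℂ v z₀)
    (hmax : ∀ᶠ z in 𝓝 z₀, ‖Ψ z‖ * (1 + ‖v z‖ ^ 2) * (R ^ 2 - ‖z‖ ^ 2) ^ 4 ≤
      ‖Ψ z₀‖ * (1 + ‖v z₀‖ ^ 2) * (R ^ 2 - ‖z₀‖ ^ 2) ^ 4) :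
    ‖deriv v z₀‖ ^ 2 * (R ^ 2 - ‖z₀‖ ^ 2) ^ 2 ≤ 16 * R ^ 2 * (1 + ‖v z₀‖ ^ 2) ^ 2 := by
  by_contra! hcon
  have hR : 0 < R := (norm_nonneg _).trans_lt hz₀
  set S : ℝ := R ^ 2 - ‖z₀‖ ^ 2 with hS
  have hSpos : 0 < S := by nlinarith [norm_nonneg z₀]
  set y : ℝ := (1 + ‖v z₀‖ ^ 2) with hy
  have hypos : 0 < y := by positivity
  set τ : ℝ := R ^ 2 / S ^ 2 with hτ
  have hτpos : 0 < τ := by positivity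
  have hτ' : 16 * τ * y ^ 2 < ‖deriv v z₀‖ ^ 2 := by
    rw [hτ, mul_div_assoc', div_mul_eq_mul_div, div_lt_iff₀ (by positivity)]
    exact hcon
  obtain ⟨H, hH, hH0, hHle⟩ := hv.eventually_norm_sq_mul_one_add_le (k := 16 * τ) hτ'
  set P : ℂ → ℂ := fun z => Ψ z * H z ^ 2 * ((R : ℂ) ^ 2 - (starRingEnd ℂ) z₀ * z) ^ 8 with hP
  have hPa : AnalyticAt ℂ P z₀ := by
    have : AnalyticAt ℂ (fun z : ℂ => z) z₀ := analyticAt_id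
    fun_prop
  have hw0 : ‖(R : ℂ) ^ 2 - (starRingEnd ℂ) z₀ * z₀‖ = S := by
    rw [Complex.conj_mul']
    rw [← Complex.ofReal_pow, ← Complex.ofReal_pow, ← Complex.ofReal_sub, Complex.norm_real,
      Real.norm_of_nonneg hSpos.le]
  have hP0n : ‖P z₀‖ = ‖Ψ z₀‖ * y * S ^ 8 := by
    simp only [hP, norm_mul, norm_pow]
    rw [hw0, hH0]
  have hP0 : P z₀ ≠ 0 := by
    rw [← norm_pos_iff, hP0n]
    have := norm_pos_iff.2 hΨ0
    positivity
  have hid : ∀ z : ℂ, ‖(R : ℂ) ^ 2 - (starRingEnd ℂ) z₀ * z‖ ^ 2 =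
      (R ^ 2 - ‖z‖ ^ 2) * S + R ^ 2 * ‖z - z₀‖ ^ 2 := by
    intro z
    rw [hS, ← Complex.normSq_eq_norm_sq, ← Complex.normSq_eq_norm_sq, ← Complex.normSq_eq_norm_sq,
      ← Complex.normSq_eq_norm_sq]
    simp [Complex.normSq_apply, ← Complex.ofReal_pow]
    ring
  refine not_eventually_norm_mul_one_add_le hPa hP0 (A := τ) hτpos ?_
  have hcW : ContinuousAt (fun z : ℂ => R ^ 2 * S) z₀ := continuousAt_const
  have hcW' : ContinuousAt (fun z : ℂ => 2 * ‖(R : ℂ) ^ 2 - (starRingEnd ℂ) z₀ * z‖ ^ 2 *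
      R ^ 2 / S) z₀ := by
    fun_prop
  have hcs : ContinuousAt (fun z : ℂ => 32 * τ * ‖z - z₀‖ ^ 2) z₀ := by fun_prop
  have hlt := hcW.eventually_lt hcW' (by
    simp only [hw0]
    rw [lt_div_iff₀ hSpos]
    have : 0 < S ^ 2 * R ^ 2 := by positivity
    nlinarith)
  have hlt2 := hcs.eventually_lt (continuousAt_const (y := (1 : ℝ))) (by simp)
  filter_upwards [hmax, hHle, hlt, hlt2] with z h1 h2 h3 h4
  set s : ℝ := ‖z - z₀‖ ^ 2 with hs
  have hs0 : 0 ≤ s := by positivity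
  set W : ℝ := ‖(R : ℂ) ^ 2 - (starRingEnd ℂ) z₀ * z‖ ^ 2 with hW
  have hW0 : 0 ≤ W := by positivity
  set t := τ * s with ht
  have ht0 : 0 ≤ t := by positivity
  have ht1 : 32 * t < 1 := by rw [ht]; linarith
  -- the factor involving the radius
  have h5 : W * (1 - 2 * t) ≤ (R ^ 2 - ‖z‖ ^ 2) * S := by
    have e1 := hid z
    have e2 : R ^ 2 * S ≤ 2 * W * R ^ 2 / S := h3.le
    rw [le_div_iff₀ hSpos] at e2
    have e3 : R ^ 2 ≤ 2 * W * τ := by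
      rw [hτ, mul_div_assoc', le_div_iff₀ (by positivity)]
      nlinarith
    have e4 : R ^ 2 * s ≤ 2 * W * τ * s := by gcongr
    have e5 : W = (R ^ 2 - ‖z‖ ^ 2) * S + R ^ 2 * s := e1
    have e6 : 2 * W * τ * s = W * (2 * t) := by rw [ht]; ring
    linarith
  have h6 : (W * (1 - 2 * t)) ^ 4 ≤ ((R ^ 2 - ‖z‖ ^ 2) * S) ^ 4 := by
    apply pow_le_pow_left₀ _ h5
    apply mul_nonneg hW0; linarith
  have h7 := one_add_le_one_add_mul_one_sub_pow ht0 ht1.le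
  have hPn : ‖P z‖ = ‖Ψ z‖ * ‖H z‖ ^ 2 * W ^ 4 := by
    simp only [hP, norm_mul, norm_pow, hW]
    ring
  rw [hPn, hP0n]
  have h2' : ‖H z‖ ^ 2 * (1 + 16 * t) ≤ 1 + ‖v z‖ ^ 2 := by
    rw [ht]; rw [← mul_assoc]; exact h2
  calc ‖Ψ z‖ * ‖H z‖ ^ 2 * W ^ 4 * (1 + t)
      ≤ ‖Ψ z‖ * ‖H z‖ ^ 2 * W ^ 4 * ((1 + 16 * t) * (1 - 2 * t) ^ 4) := by gcongr
    _ = ‖Ψ z‖ * (‖H z‖ ^ 2 * (1 + 16 * t)) * (W * (1 - 2 * t)) ^ 4 := by ring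
    _ ≤ ‖Ψ z‖ * (1 + ‖v z‖ ^ 2) * ((R ^ 2 - ‖z‖ ^ 2) * S) ^ 4 := by gcongr
    _ = (‖Ψ z‖ * (1 + ‖v z‖ ^ 2) * (R ^ 2 - ‖z‖ ^ 2) ^ 4) * S ^ 4 := by ring
    _ ≤ (‖Ψ z₀‖ * y * S ^ 4) * S ^ 4 := by gcongr
    _ = _ := by ring

theorem AnalyticAt.eventually_deriv_eq_of_eventuallyEq_pow_smul {u w : ℂ → ℂ} {z₀ : ℂ} {m : ℕ}
    (hw : AnalyticAt ℂ w z₀) (hm : ∀ᶠ z in 𝓝 z₀, u z = (z - z₀) ^ m • w z) :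
    ∀ᶠ z in 𝓝 z₀, deriv u z = m * (z - z₀) ^ (m - 1) * w z + (z - z₀) ^ m * deriv w z := by
  filter_upwards [hm.eventually_nhds, hw.eventually_analyticAt] with z h2 h3
  rw [Filter.EventuallyEq.deriv_eq (f := fun z => (z - z₀) ^ m * w z) h2]
  have := ((((hasDerivAt_id z).sub_const z₀).pow m).mul h3.differentiableAt.hasDerivAt).deriv
  simp only [id, Pi.mul_def, Pi.pow_def] at this
  rw [this]
  ring

theorem AnalyticAt.exists_deriv_sq_eq_mul {u : ℂ → ℂ} {z₀ : ℂ} (hu : AnalyticAt ℂ u z₀)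
    (h0 : u z₀ = 0) (h1 : deriv u z₀ = 0) :
    ∃ q : ℂ → ℂ, AnalyticAt ℂ q z₀ ∧ ∀ᶠ z in 𝓝 z₀, deriv u z ^ 2 = q z * u z := by
  by_cases hz : ∀ᶠ z in 𝓝 z₀, u z = 0
  · refine ⟨0, analyticAt_const, ?_⟩
    filter_upwards [hz, hz.eventually_nhds] with z h2 h3
    have : deriv u z = 0 := by
      rw [Filter.EventuallyEq.deriv_eq (f := fun _ => (0 : ℂ)) h3]
      simp
    simp [h2, this]
  · obtain ⟨m, w, hw, hw0, hm⟩ := hu.exists_eventuallyEq_pow_smul_nonzero_iff.2 hz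
    have hderiv := hw.eventually_deriv_eq_of_eventuallyEq_pow_smul hm
    obtain rfl | rfl | ⟨k, rfl⟩ : m = 0 ∨ m = 1 ∨ ∃ k, m = k + 2 := by
      rcases m with _ | _ | k
      · simp
      · simp
      · exact Or.inr (Or.inr ⟨k, rfl⟩)
    · have := hm.self_of_nhds
      simp [h0] at this
      exact absurd this.symm hw0
    · have := hderiv.self_of_nhds
      simp [h1] at this
      exact absurd this.symm hw0
    · refine ⟨fun z => (z - z₀) ^ k * ((k + 2) * w z + (z - z₀) * deriv w z) ^ 2 / w z, ?_, ?_⟩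
      · have : AnalyticAt ℂ (fun z : ℂ => z) z₀ := analyticAt_id
        have := hw.deriv
        refine AnalyticAt.div ?_ hw hw0
        fun_prop
      · filter_upwards [hm, hderiv, hw.continuousAt.eventually_ne hw0] with z h2 h3 h4
        rw [h2, h3]
        simp only [smul_eq_mul]
        rw [show k + 2 - 1 = k + 1 from rfl]
        push_cast
        field_simp
        ring

theorem AnalyticAt.exists_sq_eq_of_ne_zero {w : ℂ → ℂ} {z₀ : ℂ} (hw : AnalyticAt ℂ w z₀)
    (h0 : w z₀ ≠ 0) :
    ∃ v : ℂ → ℂ, AnalyticAt ℂ v z₀ ∧ ∀ᶠ z in 𝓝 z₀, v z ^ 2 = w z := by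
  obtain ⟨c, hc⟩ := IsAlgClosed.exists_pow_nat_eq (w z₀) two_pos
  have hd : AnalyticAt ℂ (fun z => w z / w z₀) z₀ := hw.div analyticAt_const h0
  refine ⟨fun z => c * (w z / w z₀) ^ ((2 : ℕ)⁻¹ : ℂ), ?_, .of_forall fun z => ?_⟩
  · exact analyticAt_const.mul (hd.cpow analyticAt_const (by simp [h0]))
  · rw [mul_pow, Complex.cpow_nat_inv_pow _ two_ne_zero, hc, mul_div_cancel₀ _ h0]

theorem AnalyticAt.exists_sq_eq_of_deriv_sq_eq {u q : ℂ → ℂ} {z₀ : ℂ} (hu : AnalyticAt ℂ u z₀)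
    (hq : AnalyticAt ℂ q z₀) (hq0 : q z₀ ≠ 0) (hne : ¬ ∀ᶠ z in 𝓝 z₀, u z = 0)
    (huq : ∀ᶠ z in 𝓝 z₀, deriv u z ^ 2 = q z * u z) :
    ∃ v : ℂ → ℂ, AnalyticAt ℂ v z₀ ∧ (∀ᶠ z in 𝓝 z₀, v z ^ 2 = u z) ∧
      4 * deriv v z₀ ^ 2 = q z₀ := by
  have hune : ∀ᶠ z in 𝓝[≠] z₀, u z ≠ 0 := by
    rcases hu.eventually_eq_zero_or_eventually_ne_zero with h | h
    · exact absurd h hne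
    · exact h
  obtain ⟨v, hv, hvu⟩ : ∃ v : ℂ → ℂ, AnalyticAt ℂ v z₀ ∧ ∀ᶠ z in 𝓝 z₀, v z ^ 2 = u z := by
    obtain ⟨m, w, hw, hw0, hm⟩ := hu.exists_eventuallyEq_pow_smul_nonzero_iff.2 hne
    obtain ⟨y, hy, hyw⟩ := hw.exists_sq_eq_of_ne_zero hw0
    have hid : AnalyticAt ℂ (fun z : ℂ => z) z₀ := analyticAt_id
    have hderiv := hw.eventually_deriv_eq_of_eventuallyEq_pow_smul hm
    obtain rfl | rfl | ⟨k, rfl⟩ : m = 0 ∨ m = 1 ∨ ∃ k, m = k + 2 := by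
      rcases m with _ | _ | k
      · simp
      · simp
      · exact Or.inr (Or.inr ⟨k, rfl⟩)
    · refine ⟨y, hy, ?_⟩
      filter_upwards [hyw, hm] with z h1 h2
      rw [h1, h2]; simp
    · have h1 := huq.self_of_nhds
      rw [hderiv.self_of_nhds, hm.self_of_nhds] at h1
      simp at h1
      exact absurd h1 hw0
    · -- the order of vanishing is exactly two
      have hk : k = 0 := by
        have h1 : ∀ᶠ z in 𝓝[≠] z₀,
            (z - z₀) ^ k * ((k + 2) * w z + (z - z₀) * deriv w z) ^ 2 = q z * w z := by
          filter_upwards [huq.filter_mono nhdsWithin_le_nhds, hm.filter_mono nhdsWithin_le_nhds,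
            hderiv.filter_mono nhdsWithin_le_nhds, self_mem_nhdsWithin] with z h2 h3 h4 h5
          have h6 : (z - z₀) ^ (k + 2) ≠ 0 := pow_ne_zero _ (sub_ne_zero.2 h5)
          apply mul_left_cancel₀ h6
          rw [h3, h4] at h2
          simp only [smul_eq_mul] at h2
          rw [show k + 2 - 1 = k + 1 from rfl] at h2
          push_cast at h2
          linear_combination h2
        have hdw := hw.deriv
        have h2 : AnalyticAt ℂ
            (fun z => (z - z₀) ^ k * ((k + 2) * w z + (z - z₀) * deriv w z) ^ 2) z₀ := by
          fun_prop
        have h3 := ((h2.frequently_eq_iff_eventually_eq (hq.mul hw)).1 h1.frequently).self_of_nhds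
        by_contra hk
        simp [hk] at h3
        exact h3.elim hq0 hw0
      subst hk
      refine ⟨fun z => (z - z₀) * y z, (hid.sub analyticAt_const).mul hy, ?_⟩
      filter_upwards [hyw, hm] with z h1 h2
      rw [h2, mul_pow, h1]; simp
  refine ⟨v, hv, hvu, ?_⟩
  have h1 : ∀ᶠ z in 𝓝[≠] z₀, 4 * deriv v z ^ 2 = q z := by
    filter_upwards [hvu.filter_mono nhdsWithin_le_nhds,
      (hvu.eventually_nhds).filter_mono nhdsWithin_le_nhds, huq.filter_mono nhdsWithin_le_nhds, hune,
      hv.eventually_analyticAt.filter_mono nhdsWithin_le_nhds] with z h2 h3 h4 h5 h6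
    have h7 : deriv u z = 2 * v z * deriv v z := by
      rw [← Filter.EventuallyEq.deriv_eq (f₁ := fun z => v z ^ 2) h3]
      have := (h6.differentiableAt.hasDerivAt.pow 2).deriv
      simp only [Pi.pow_def] at this
      rw [this]; simp
    apply mul_right_cancel₀ h5
    rw [← h4, h7, ← h2]
    ring
  have h2 : AnalyticAt ℂ (fun z => 4 * deriv v z ^ 2) z₀ := analyticAt_const.mul (hv.deriv.pow 2)
  exact ((h2.frequently_eq_iff_eventually_eq hq).1 h1.frequently).self_of_nhds

theorem exists_analyticOnNhd_eq_mul {U : Set ℂ} {F G : ℂ → ℂ}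
    (hloc : ∀ z₀ ∈ U, ∃ q : ℂ → ℂ, AnalyticAt ℂ q z₀ ∧ ∀ᶠ z in 𝓝 z₀, F z = q z * G z)
    (hG : ∀ z₀ ∈ U, ∀ᶠ z in 𝓝[≠] z₀, G z ≠ 0) (hU : IsOpen U) :
    ∃ Φ : ℂ → ℂ, AnalyticOnNhd ℂ Φ U ∧ ∀ z ∈ U, F z = Φ z * G z := by
  choose! q hq hFq using hloc
  refine ⟨fun z => q z z, fun z₀ hz₀ => ?_, fun z hz => (hFq z hz).self_of_nhds⟩
  refine (hq z₀ hz₀).congr ?_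
  have h1 : ∀ᶠ z in 𝓝[≠] z₀, q z₀ z = q z z := by
    filter_upwards [(hFq z₀ hz₀).filter_mono nhdsWithin_le_nhds, hG z₀ hz₀,
      mem_nhdsWithin_of_mem_nhds (hU.mem_nhds hz₀)] with z h2 h3 h4
    exact mul_right_cancel₀ h3 (h2.symm.trans (hFq z h4).self_of_nhds)
  rw [eventually_nhdsWithin_iff] at h1
  filter_upwards [h1] with z hz
  by_cases h : z = z₀
  · rw [h]
  · exact hz h

theorem exists_norm_le_one_and_mul_eq_norm (x : ℂ) : ∃ c : ℂ, ‖c‖ ≤ 1 ∧ c * x = ‖x‖ := by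
  refine ⟨(starRingEnd ℂ) x / ‖x‖, ?_, ?_⟩
  · rw [norm_div, RCLike.norm_conj, Complex.norm_real, norm_norm]
    exact div_self_le_one _
  · rw [div_mul_eq_mul_div, Complex.conj_mul']
    by_cases h : (‖x‖ : ℂ) = 0
    · simp [h]
    · field_simp

open Metric Set in
theorem eventually_prod_sub_ne_zero {ι : Type*} [Fintype ι] (a : ι → ℂ) {g : ℂ → ℂ} {R : ℝ}
    (hg : DifferentiableOn ℂ g (ball 0 R)) (h0 : deriv g 0 ≠ 0) {z₀ : ℂ} (hz₀ : z₀ ∈ ball 0 R) :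
    ∀ᶠ z in 𝓝[≠] z₀, ∏ i, (g z - a i) ≠ 0 := by
  have hR : 0 < R := pos_of_mem_ball hz₀
  simp only [Finset.prod_ne_zero_iff, Finset.mem_univ, true_imp_iff]
  rw [eventually_all]
  intro i
  have han : AnalyticOnNhd ℂ (fun z => g z - a i) (ball 0 R) :=
    (hg.sub_const _).analyticOnNhd isOpen_ball
  rcases (han z₀ hz₀).eventually_eq_zero_or_eventually_ne_zero with h | h
  · have h1 := han.eqOn_zero_of_preconnected_of_eventuallyEq_zero
      (convex_ball 0 R).isPreconnected hz₀ h
    have h2 : g =ᶠ[𝓝 0] fun _ => a i := by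
      filter_upwards [isOpen_ball.mem_nhds (mem_ball_self hR)] with z hz
      exact sub_eq_zero.1 (h1 hz)
    rw [h2.deriv_eq] at h0
    simp at h0
  · exact h

open Metric Set in
theorem exists_deriv_sq_eq_mul_prod {ι : Type*} [Fintype ι] [DecidableEq ι] {a : ι → ℂ}
    (ha : Function.Injective a)
    {g : ℂ → ℂ} {R : ℝ} (hg : DifferentiableOn ℂ g (ball 0 R)) (h0 : deriv g 0 ≠ 0)
    (hmult : ∀ i, ∀ z ∈ ball (0 : ℂ) R, g z = a i → deriv g z = 0) :
    ∃ Φ : ℂ → ℂ, AnalyticOnNhd ℂ Φ (ball 0 R) ∧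
      ∀ z ∈ ball (0 : ℂ) R, deriv g z ^ 2 = Φ z * ∏ i, (g z - a i) := by
  refine exists_analyticOnNhd_eq_mul (F := fun z => deriv g z ^ 2) (fun z₀ hz₀ => ?_)
    (fun z₀ hz₀ => eventually_prod_sub_ne_zero a hg h0 hz₀) isOpen_ball
  have hgz : AnalyticAt ℂ g z₀ := hg.analyticOnNhd isOpen_ball z₀ hz₀
  by_cases hex : ∃ j, g z₀ = a j
  · obtain ⟨j, hj⟩ := hex
    have hu : AnalyticAt ℂ (fun z => g z - a j) z₀ := hgz.sub analyticAt_const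
    have hud : ∀ z, deriv (fun z => g z - a j) z = deriv g z := fun z => deriv_sub_const _
    obtain ⟨q, hq, hqu⟩ := hu.exists_deriv_sq_eq_mul (by simp [hj])
      (by rw [hud]; exact hmult j z₀ hz₀ hj)
    have hprod : AnalyticAt ℂ (fun z => ∏ i ∈ Finset.univ.erase j, (g z - a i)) z₀ :=
      Finset.analyticAt_fun_prod _ fun i _ => hgz.sub analyticAt_const
    have hne : ∏ i ∈ Finset.univ.erase j, (g z₀ - a i) ≠ 0 := by
      rw [Finset.prod_ne_zero_iff]
      intro i hi
      rw [hj, sub_ne_zero]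
      exact fun h => (Finset.ne_of_mem_erase hi) (ha h).symm
    refine ⟨_, hq.div hprod hne, ?_⟩
    filter_upwards [hqu, hprod.continuousAt.eventually_ne hne] with z h1 h2
    rw [hud] at h1
    rw [h1, ← Finset.mul_prod_erase _ _ (Finset.mem_univ j)]
    simp only [Pi.div_apply]
    field_simp
  · have hprod : AnalyticAt ℂ (fun z => ∏ i, (g z - a i)) z₀ :=
      Finset.analyticAt_fun_prod _ fun i _ => hgz.sub analyticAt_const
    have hne : ∏ i, (g z₀ - a i) ≠ 0 := by
      rw [Finset.prod_ne_zero_iff]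
      exact fun i _ => sub_ne_zero.2 fun h => hex ⟨i, h⟩
    refine ⟨_, (hgz.deriv.pow 2).div hprod hne, ?_⟩
    filter_upwards [hprod.continuousAt.eventually_ne hne] with z h2
    simp only [Pi.div_apply, Pi.pow_apply]
    field_simp

open Metric Set in
theorem norm_mul_prod_erase_le_of_isMaxOn {ι : Type*} [Fintype ι] [DecidableEq ι] {a : ι → ℂ}
    {g Φ : ℂ → ℂ} {R : ℝ} {z₀ : ℂ} (hz₀ : ‖z₀‖ < R) (hg : AnalyticAt ℂ g z₀)
    (hΦ : AnalyticAt ℂ Φ z₀) (hΦ0 : Φ z₀ ≠ 0)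
    (hgΦ : ∀ᶠ z in 𝓝 z₀, deriv g z ^ 2 = Φ z * ∏ i, (g z - a i))
    (hne : ∀ᶠ z in 𝓝[≠] z₀, ∏ i, (g z - a i) ≠ 0)
    (hmax : IsMaxOn (fun z => ‖Φ z‖ ^ 2 * (∏ i, (1 + ‖g z - a i‖)) * (R ^ 2 - ‖z‖ ^ 2) ^ 4)
      (closedBall 0 R) z₀)
    {j : ι} (hj : ∏ i ∈ Finset.univ.erase j, (g z₀ - a i) ≠ 0) :
    ‖Φ z₀‖ * (∏ i ∈ Finset.univ.erase j, ‖g z₀ - a i‖) * (R ^ 2 - ‖z₀‖ ^ 2) ^ 2 ≤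
      64 * R ^ 2 * (1 + ‖g z₀ - a j‖) ^ 2 := by
  have hu : AnalyticAt ℂ (fun z => g z - a j) z₀ := hg.sub analyticAt_const
  have hud : ∀ z, deriv (fun z => g z - a j) z = deriv g z := fun z => deriv_sub_const _
  have hprod : AnalyticAt ℂ (fun z => ∏ i ∈ Finset.univ.erase j, (g z - a i)) z₀ :=
    Finset.analyticAt_fun_prod _ fun i _ => hg.sub analyticAt_const
  obtain ⟨v, hv, hvu, hv4⟩ := hu.exists_sq_eq_of_deriv_sq_eq
    (q := fun z => Φ z * ∏ i ∈ Finset.univ.erase j, (g z - a i)) (hΦ.mul hprod)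
    (mul_ne_zero hΦ0 hj)
    (by
      intro h
      obtain ⟨z, h1, h2⟩ := ((h.filter_mono nhdsWithin_le_nhds).and hne).exists
      exact h2 (Finset.prod_eq_zero (Finset.mem_univ j) h1))
    (by
      filter_upwards [hgΦ] with z hz
      rw [hud, hz, ← Finset.mul_prod_erase _ _ (Finset.mem_univ j)]
      ring)
  choose c hc hcx using fun i => exists_norm_le_one_and_mul_eq_norm (g z₀ - a i)
  have hn0 : ∀ i, ‖1 + c i * (g z₀ - a i)‖ = 1 + ‖g z₀ - a i‖ := by
    intro i
    rw [hcx, ← Complex.ofReal_one, ← Complex.ofReal_add, Complex.norm_real,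
      Real.norm_of_nonneg (by positivity)]
  have hn : ∀ i z, ‖1 + c i * (g z - a i)‖ ≤ 1 + ‖g z - a i‖ := by
    intro i z
    refine (norm_add_le _ _).trans ?_
    rw [norm_one, norm_mul]
    gcongr
    exact mul_le_of_le_one_left (norm_nonneg _) (hc i)
  have hvn : ∀ᶠ z in 𝓝 z₀, ‖v z‖ ^ 2 = ‖g z - a j‖ := by
    filter_upwards [hvu] with z hz
    rw [← hz, norm_pow]
  have hΨ : AnalyticAt ℂ
      (fun z => Φ z ^ 2 * ∏ i ∈ Finset.univ.erase j, (1 + c i * (g z - a i))) z₀ :=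
    (hΦ.pow 2).mul (Finset.analyticAt_fun_prod _ fun i _ =>
      analyticAt_const.add (analyticAt_const.mul (hg.sub analyticAt_const)))
  have key := sq_norm_deriv_mul_le_of_eventually_le hz₀ hΨ ?_ hv ?_
  · have h4 : 4 * ‖deriv v z₀‖ ^ 2 =
        ‖Φ z₀‖ * ∏ i ∈ Finset.univ.erase j, ‖g z₀ - a i‖ := by
      rw [← norm_prod, ← norm_mul, ← hv4, norm_mul, norm_pow]
      simp
    rw [← h4, ← hvn.self_of_nhds]
    linarith
  · refine mul_ne_zero (pow_ne_zero _ hΦ0) ?_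
    rw [Finset.prod_ne_zero_iff]
    intro i _
    rw [← norm_pos_iff, hn0]
    positivity
  · have hball : ∀ᶠ z in 𝓝 z₀, z ∈ ball (0 : ℂ) R :=
      isOpen_ball.mem_nhds (by simpa using hz₀)
    filter_upwards [hvn, hball] with z hz hzR
    have h1 := hmax (ball_subset_closedBall hzR)
    simp only [mem_ofPred_eq] at h1
    rw [← Finset.mul_prod_erase _ _ (Finset.mem_univ j),
      ← Finset.mul_prod_erase _ _ (Finset.mem_univ j)] at h1
    rw [hz, hvn.self_of_nhds]
    simp only [norm_mul, norm_pow, norm_prod, hn0]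
    have hpos : 0 ≤ R ^ 2 - ‖z‖ ^ 2 := by
      have : ‖z‖ < R := by simpa using hzR
      nlinarith [norm_nonneg z]
    have hp : ∏ i ∈ Finset.univ.erase j, ‖1 + c i * (g z - a i)‖ ≤
        ∏ i ∈ Finset.univ.erase j, (1 + ‖g z - a i‖) :=
      Finset.prod_le_prod (fun _ _ => norm_nonneg _) fun i _ => hn i z
    calc _ ≤ ‖Φ z‖ ^ 2 * (∏ i ∈ Finset.univ.erase j, (1 + ‖g z - a i‖)) *
          (1 + ‖g z - a j‖) * (R ^ 2 - ‖z‖ ^ 2) ^ 4 := by gcongr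
      _ = _ := by ring
      _ ≤ _ := h1
      _ = _ := by ring

/-- Quantitative separation of a finite set of points. -/
theorem exists_pos_mul_one_add_norm_sub_le {ι : Type*} [Finite ι] [Nontrivial ι] {a : ι → ℂ}
    (ha : Function.Injective a) : ∃ η : ℝ, 0 < η ∧ ∀ w : ℂ, ∃ j, ∀ i ≠ j,
      η * (1 + ‖w - a i‖) ≤ ‖w - a i‖ ∧ ‖w - a j‖ ≤ ‖w - a i‖ := by
  obtain ⟨i₀, j₀, hij₀⟩ := exists_pair_ne ι
  have : Nonempty {p : ι × ι // p.1 ≠ p.2} := ⟨⟨(i₀, j₀), hij₀⟩⟩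
  obtain ⟨p, hp⟩ := Finite.exists_min fun p : {p : ι × ι // p.1 ≠ p.2} => ‖a p.1.1 - a p.1.2‖
  set δ : ℝ := ‖a p.1.1 - a p.1.2‖ / 2 with hδ
  have hδ0 : 0 < δ := half_pos (norm_pos_iff.2 (sub_ne_zero.2 fun h => p.2 (ha h)))
  refine ⟨δ / (1 + δ), by positivity, fun w => ?_⟩
  obtain ⟨j, hj⟩ := Finite.exists_min fun i => ‖w - a i‖
  refine ⟨j, fun i hij => ⟨?_, hj i⟩⟩
  have h1 := hp ⟨(i, j), hij⟩
  have h2 : ‖a i - a j‖ ≤ ‖w - a i‖ + ‖w - a j‖ := by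
    rw [show a i - a j = (w - a j) - (w - a i) by ring, add_comm]
    exact norm_sub_le _ _
  have h3 := hj i
  simp only at h1
  have h4 : δ ≤ ‖w - a i‖ := by rw [hδ]; linarith
  rw [div_mul_eq_mul_div, div_le_iff₀ (by positivity)]
  linarith

theorem mul_pow_ten_le {b y Q p S η R : ℝ} (hb : 0 ≤ b) (hy : 0 ≤ y) (hη : 0 ≤ η)
    (hQ : 0 < Q) (hp : η ^ 5 * Q ≤ p) (hyQ : y ^ 5 ≤ Q)
    (h : b * p * S ^ 2 ≤ 64 * R ^ 2 * y ^ 2) :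
    b ^ 2 * (y * Q) * S ^ 4 * η ^ 10 ≤ 4096 * R ^ 4 := by
  refine le_of_mul_le_mul_right ?_ hQ
  have hp0 : 0 ≤ p := le_trans (by positivity) hp
  calc b ^ 2 * (y * Q) * S ^ 4 * η ^ 10 * Q
      = y * (b * (η ^ 5 * Q) * S ^ 2) ^ 2 := by ring
    _ ≤ y * (b * p * S ^ 2) ^ 2 := by gcongr
    _ ≤ y * (64 * R ^ 2 * y ^ 2) ^ 2 := by gcongr
    _ = 4096 * R ^ 4 * y ^ 5 := by ring
    _ ≤ 4096 * R ^ 4 * Q := by gcongr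

theorem pow_mul_pow_ten_le {b x X A t η R : ℝ} (hx : 0 ≤ x) (hxX : x ≤ X) (hX : 0 < X)
    (hA : X ≤ (A * t) ^ 6) (hR : 0 < R) (ht : 1 ≤ t) (hbx : b * x = t ^ 4)
    (h : b ^ 2 * X * R ^ 8 * η ^ 10 ≤ 4096 * R ^ 4) : R ^ 4 * η ^ 10 ≤ 4096 * A ^ 6 := by
  have h1 : t ^ 8 * R ^ 4 * η ^ 10 ≤ 4096 * X := by
    refine le_of_mul_le_mul_right ?_ (show 0 < R ^ 4 * X by positivity)
    calc t ^ 8 * R ^ 4 * η ^ 10 * (R ^ 4 * X)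
        = (b * x) ^ 2 * R ^ 4 * η ^ 10 * (R ^ 4 * X) := by rw [hbx]; ring
      _ = b ^ 2 * X * R ^ 8 * η ^ 10 * x ^ 2 := by ring
      _ ≤ 4096 * R ^ 4 * X ^ 2 := by gcongr
      _ = 4096 * X * (R ^ 4 * X) := by ring
  refine le_of_mul_le_mul_right ?_ (show 0 < t ^ 6 by positivity)
  have h10 : 0 ≤ R ^ 4 * η ^ 10 := by positivity
  calc R ^ 4 * η ^ 10 * t ^ 6 ≤ R ^ 4 * η ^ 10 * t ^ 8 :=
        mul_le_mul_of_nonneg_left (pow_le_pow_right₀ ht (by norm_num)) h10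
    _ = t ^ 8 * R ^ 4 * η ^ 10 := by ring
    _ ≤ 4096 * X := h1
    _ ≤ 4096 * (A * t) ^ 6 := by gcongr
    _ = 4096 * A ^ 6 * t ^ 6 := by ring

open Metric Set in
/-- An effective form of Picard's theorem with ramification: on large disks, a normalized
holomorphic function attains one of six given values with multiplicity one. -/
theorem exists_radius_forall_exists_simple_root {a : Fin 6 → ℂ} (ha : Function.Injective a) :
    ∃ R : ℝ, 0 < R ∧ ∀ R', R < R' → ∀ g : ℂ → ℂ, DifferentiableOn ℂ g (ball 0 R') →
      ‖deriv g 0‖ = (1 + ‖g 0‖) ^ 2 → ∃ j, ∃ z ∈ ball (0 : ℂ) R', g z = a j ∧ deriv g z ≠ 0 := by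
  obtain ⟨η, hη, hsep⟩ := exists_pos_mul_one_add_norm_sub_le ha
  obtain ⟨j₁, hj₁⟩ := Finite.exists_max fun i => ‖a i‖
  obtain ⟨A, hA⟩ : ∃ A : ℝ, A = 1 + ‖a j₁‖ := ⟨_, rfl⟩
  have hA0 : 0 < A := by rw [hA]; positivity
  obtain ⟨R, hRdef⟩ : ∃ R : ℝ, R = 1 + 4096 * A ^ 6 / η ^ 10 := ⟨_, rfl⟩
  have hR1 : 1 ≤ R := by rw [hRdef]; linarith [show 0 ≤ 4096 * A ^ 6 / η ^ 10 by positivity]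
  have hR : 0 < R := by linarith
  refine ⟨R, hR, fun R' hRR' g hg hg0 => ?_⟩
  by_contra! hmult
  have hd0 : deriv g 0 ≠ 0 := by
    rw [← norm_pos_iff, hg0]
    positivity
  obtain ⟨Φ, hΦ, hgΦ⟩ := exists_deriv_sq_eq_mul_prod ha hg hd0 hmult
  have hsub : closedBall (0 : ℂ) R ⊆ ball 0 R' := closedBall_subset_ball hRR'
  have h0mem : (0 : ℂ) ∈ closedBall (0 : ℂ) R := mem_closedBall_self hR.le
  obtain ⟨E, hE⟩ : ∃ E : ℂ → ℝ,
      E = fun z => ‖Φ z‖ ^ 2 * (∏ i, (1 + ‖g z - a i‖)) * (R ^ 2 - ‖z‖ ^ 2) ^ 4 := ⟨_, rfl⟩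
  have hEc : ContinuousOn E (closedBall 0 R) := by
    rw [hE]
    have h1 := hΦ.continuousOn.mono hsub
    have h2 := hg.continuousOn.mono hsub
    refine ((h1.norm.pow 2).mul (continuousOn_finsetProd _ fun i _ => ?_)).mul ?_
    · exact continuousOn_const.add (h2.sub continuousOn_const).norm
    · fun_prop
  obtain ⟨z₀, hz₀, hmax⟩ := (isCompact_closedBall (0 : ℂ) R).exists_isMaxOn ⟨0, h0mem⟩ hEc
  obtain ⟨t, ht⟩ : ∃ t : ℝ, t = 1 + ‖g 0‖ := ⟨_, rfl⟩
  have ht1 : 1 ≤ t := by rw [ht]; linarith [norm_nonneg (g 0)]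
  have hgΦ0 : ‖Φ 0‖ * ∏ i, ‖g 0 - a i‖ = t ^ 4 := by
    rw [← norm_prod, ← norm_mul, ← hgΦ 0 (hsub h0mem), norm_pow, hg0, ht]
    ring
  have hprod0 : ∏ i, ‖g 0 - a i‖ ≤ ∏ i, (1 + ‖g 0 - a i‖) :=
    Finset.prod_le_prod (fun _ _ => norm_nonneg _) fun i _ => by linarith
  have hprodA : ∏ i, (1 + ‖g 0 - a i‖) ≤ (A * t) ^ 6 := by
    calc ∏ i, (1 + ‖g 0 - a i‖) ≤ ∏ _i : Fin 6, (A * t) := by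
          refine Finset.prod_le_prod (fun _ _ => by positivity) fun i _ => ?_
          have h1 := norm_sub_le (g 0) (a i)
          have h2 := hj₁ i
          have h3 : 0 ≤ ‖a j₁‖ * ‖g 0‖ := by positivity
          rw [hA, ht]
          linarith
      _ = _ := by simp
  have hΦ00 : Φ 0 ≠ 0 := by
    intro h
    rw [h, norm_zero, zero_mul] at hgΦ0
    exact (pow_pos (by linarith) 4).ne hgΦ0
  have hE0 : 0 < E 0 := by
    have := norm_pos_iff.2 hΦ00
    simp only [hE, norm_zero]
    have h2 : 0 < R ^ 2 - 0 ^ 2 := by simpa using pow_pos hR 2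
    positivity
  have hEz₀ : 0 < E z₀ := hE0.trans_le (hmax h0mem)
  have hΦz₀ : Φ z₀ ≠ 0 := by
    intro h
    simp [hE, h] at hEz₀
  have hz₀R : ‖z₀‖ < R := by
    refine lt_of_le_of_ne (by simpa using hz₀) fun h => ?_
    simp [hE, h] at hEz₀
  obtain ⟨j, hj⟩ := hsep (g z₀)
  have hne : ∏ i ∈ Finset.univ.erase j, (g z₀ - a i) ≠ 0 := by
    rw [Finset.prod_ne_zero_iff]
    intro i hi
    rw [← norm_pos_iff]
    exact lt_of_lt_of_le (by positivity) (hj i (Finset.ne_of_mem_erase hi)).1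
  have hloc := norm_mul_prod_erase_le_of_isMaxOn hz₀R
    (hg.analyticOnNhd isOpen_ball z₀ (hsub hz₀)) (hΦ z₀ (hsub hz₀)) hΦz₀
    (by filter_upwards [isOpen_ball.mem_nhds (hsub hz₀)] with z hz using hgΦ z hz)
    (eventually_prod_sub_ne_zero a hg hd0 (hsub hz₀)) (hE ▸ hmax) hne
  have hcard : (Finset.univ.erase j).card = 5 := by simp
  set y : ℝ := 1 + ‖g z₀ - a j‖ with hy
  set p : ℝ := ∏ i ∈ Finset.univ.erase j, ‖g z₀ - a i‖ with hp
  set Q : ℝ := ∏ i ∈ Finset.univ.erase j, (1 + ‖g z₀ - a i‖) with hQ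
  have hp1 : η ^ 5 * Q ≤ p := by
    rw [← hcard, ← Finset.prod_const, hQ, ← Finset.prod_mul_distrib]
    exact Finset.prod_le_prod (fun _ _ => by positivity) fun i hi =>
      (hj i (Finset.ne_of_mem_erase hi)).1
  have hQ1 : y ^ 5 ≤ Q := by
    rw [← hcard, ← Finset.prod_const]
    refine Finset.prod_le_prod (fun _ _ => by positivity) fun i hi => ?_
    have := (hj i (Finset.ne_of_mem_erase hi)).2
    rw [hy]
    linarith
  have hQpos : 0 < Q := lt_of_lt_of_le (by positivity) hQ1
  have hEval : E z₀ = ‖Φ z₀‖ ^ 2 * (y * Q) * (R ^ 2 - ‖z₀‖ ^ 2) ^ 4 := by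
    simp only [hE]
    rw [← Finset.mul_prod_erase _ _ (Finset.mem_univ j)]
  have hEbound : E z₀ * η ^ 10 ≤ 4096 * R ^ 4 := by
    rw [hEval]
    exact mul_pow_ten_le (norm_nonneg _) (by positivity) hη.le hQpos hp1 hQ1 hloc
  have hE0' : E 0 * η ^ 10 ≤ 4096 * R ^ 4 :=
    (mul_le_mul_of_nonneg_right (hmax h0mem) (by positivity)).trans hEbound
  have hE0val : E 0 = ‖Φ 0‖ ^ 2 * (∏ i, (1 + ‖g 0 - a i‖)) * R ^ 8 := by
    simp only [hE, norm_zero]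
    ring
  have hfinal : R ^ 4 * η ^ 10 ≤ 4096 * A ^ 6 :=
    pow_mul_pow_ten_le (Finset.prod_nonneg fun _ _ => norm_nonneg _) hprod0
      (Finset.prod_pos fun _ _ => by positivity) hprodA hR ht1 hgΦ0 (hE0val ▸ hE0')
  have : R ≤ R ^ 4 := le_self_pow₀ hR1 (by norm_num)
  have h3 : R ≤ 4096 * A ^ 6 / η ^ 10 := by
    rw [le_div_iff₀ (by positivity)]
    exact (mul_le_mul_of_nonneg_right this (by positivity)).trans hfinal
  rw [hRdef] at h3
  linarith

theorem tendstoLocallyUniformlyOn_iff_tendsto_nhds {F : ℕ → ℂ → ℂ} {g : ℂ → ℂ} {U : Set ℂ}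
    (hg : ContinuousOn g U) : TendstoLocallyUniformlyOn F g atTop U ↔
      ∀ x ∈ U, Tendsto (fun p : ℕ × ℂ => F p.1 p.2) (atTop ×ˢ 𝓝[U] x) (𝓝 (g x)) := by
  rw [tendstoLocallyUniformlyOn_iff_forall_tendsto]
  refine forall₂_congr fun x hx => ?_
  have h1 : Tendsto (fun p : ℕ × ℂ => g p.2) (atTop ×ˢ 𝓝[U] x) (𝓝 (g x)) :=
    (hg x hx).tendsto.comp tendsto_snd
  exact ⟨fun h => (Uniform.tendsto_congr h).1 h1,
    fun h => (h1.prodMk_nhds h).mono_right (nhds_le_uniformity _)⟩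

open Metric Set in
/-- **Marty's criterion**, in contrapositive form. -/
theorem exists_lt_norm_deriv_of_not_isNormalAt {𝓕 : Set (ℂ → ℂ)}
    (hent : ∀ g ∈ 𝓕, Differentiable ℂ g) {w₀ : ℂ} (hw₀ : ¬ IsNormalAt 𝓕 univ w₀) {M r : ℝ}
    (hM : 0 < M) (hr : 0 < r) :
    ∃ F ∈ 𝓕, ∃ c ∈ ball w₀ r, M * (1 + ‖F c‖) ^ 2 < ‖deriv F c‖ := by
  by_contra! hcon
  refine hw₀ ⟨ball w₀ (min r (1 / (4 * M))), isOpen_ball, mem_ball_self (by positivity),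
    subset_univ _, fun f hf => ?_⟩
  refine exists_subseq_of_norm_deriv_le_sq hM.le ?_ (fun n => (hent _ (hf n)).differentiableOn)
    fun n z hz => hcon _ (hf n) z (ball_subset_ball (min_le_left _ _) hz)
  calc M * min r (1 / (4 * M)) ≤ M * (1 / (4 * M)) := by gcongr; exact min_le_right _ _
    _ = 1 / 4 := by field_simp

open Metric Set in
/-- A variant of **Zalcman's lemma**: limits of rescalings of a non-normal family on large disks. -/
theorem exists_rescaled_limit_of_not_isNormalAt {𝓕 : Set (ℂ → ℂ)}
    (hent : ∀ g ∈ 𝓕, Differentiable ℂ g) {w₀ : ℂ} (hw₀ : ¬ IsNormalAt 𝓕 univ w₀) {m : ℕ}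
    (hm : 0 < m) :
    ∃ (F : ℕ → ℂ → ℂ) (z : ℕ → ℂ) (ρ : ℕ → ℝ) (g : ℂ → ℂ), (∀ n, F n ∈ 𝓕) ∧ (∀ n, 0 < ρ n) ∧
      Tendsto z atTop (𝓝 w₀) ∧ Tendsto ρ atTop (𝓝 0) ∧ DifferentiableOn ℂ g (ball 0 (m / 16)) ∧
      TendstoLocallyUniformlyOn (fun n ζ => F n (z n + ρ n * ζ)) g atTop (ball 0 (m / 16)) ∧
      ‖deriv g 0‖ = (1 + ‖g 0‖) ^ 2 := by
  have hk : ∀ n : ℕ, 0 < (n : ℝ) + m + 1 := fun n => by positivity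
  choose F hF c hc hlt using fun n : ℕ => exists_lt_norm_deriv_of_not_isNormalAt hent hw₀
    (M := ((n : ℝ) + m + 1) ^ 2) (r := 1 / ((n : ℝ) + m + 1)) (by have := hk n; positivity)
    (by have := hk n; positivity)
  choose z ρ hρ hρM hd0 hball using fun n : ℕ => exists_rescaling (hent _ (hF n))
    (r := 1 / ((n : ℝ) + m + 1)) (by have := hk n; positivity) (by have := hk n; positivity) (hlt n)
  have hrM : ∀ n : ℕ, (m : ℝ) / 16 + 1 / 8 ≤
      1 / ((n : ℝ) + m + 1) * ((n : ℝ) + m + 1) ^ 2 / 2 := by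
    intro n
    have := hk n
    have e : 1 / ((n : ℝ) + m + 1) * ((n : ℝ) + m + 1) ^ 2 = (n : ℝ) + m + 1 := by field_simp
    rw [e]
    have h1 : (0 : ℝ) ≤ n := by positivity
    have h2 : (0 : ℝ) ≤ m := by positivity
    linarith
  have hpos : (0 : ℝ) < m / 16 := by positivity
  have hlim : Tendsto (fun n : ℕ => 1 / ((n : ℝ) + m + 1)) atTop (𝓝 0) := by
    have h1 : Tendsto (fun n : ℕ => (n : ℝ) + m + 1) atTop atTop :=
      tendsto_atTop_add_const_right _ _
        (tendsto_atTop_add_const_right _ _ tendsto_natCast_atTop_atTop)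
    exact h1.inv_tendsto_atTop.congr fun n => (one_div _).symm
  have hz : Tendsto z atTop (𝓝 w₀) := by
    rw [tendsto_iff_dist_tendsto_zero]
    refine squeeze_zero (fun _ => dist_nonneg) (fun n => ?_) (by simpa only [add_zero] using hlim.add hlim)
    have h1 := (hball n 0 (mem_ball_self (by have := hrM n; linarith))).1
    rw [mul_zero, add_zero, mem_ball] at h1
    have h2 := mem_ball.1 (hc n)
    have h3 := dist_triangle (z n) (c n) w₀
    linarith
  have hρ0 : Tendsto ρ atTop (𝓝 0) := by
    refine squeeze_zero (fun n => (hρ n).le) (fun n => ?_) hlim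
    rw [le_div_iff₀ (hk n)]
    refine le_trans ?_ (hρM n)
    have h1 : (1 : ℝ) ≤ (n : ℝ) + m + 1 := by
      have : (0 : ℝ) ≤ (n : ℝ) + m := by positivity
      linarith
    exact mul_le_mul_of_nonneg_left (le_self_pow₀ h1 two_ne_zero) (hρ n).le
  set h : ℕ → ℂ → ℂ := fun n ζ => F n (z n + ρ n * ζ) with hh
  have hhd : ∀ n, Differentiable ℂ (h n) := by
    intro n
    have := hent _ (hF n)
    exact this.comp (by fun_prop)
  have hhM : ∀ n, ∀ ζ ∈ ball (0 : ℂ) (m / 16 + 1 / 8),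
      ‖deriv (h n) ζ‖ ≤ 2 * (1 + ‖h n ζ‖) ^ 2 :=
    fun n ζ hζ => (hball n ζ (ball_subset_ball (hrM n) hζ)).2
  have hd0' : ∀ n, ‖deriv (h n) 0‖ = (1 + ‖h n 0‖) ^ 2 := by
    intro n
    rw [hd0 n]
    simp [hh]
  obtain ⟨B, hB⟩ := exists_norm_le_of_norm_deriv_eq_sq
  obtain ⟨B', hB'⟩ := exists_norm_le_closedBall_of_norm_deriv_le_sq B m
  have hb : ∀ n, ∀ ζ ∈ ball (0 : ℂ) (m / 16), ‖h n ζ‖ ≤ B' := fun n ζ hζ =>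
    hB' _ (hhd n).differentiableOn (hhM n)
      (hB _ (hhd n).differentiableOn
        (fun ζ hζ => hhM n ζ (ball_subset_ball (by linarith) hζ)) (hd0' n))
      ζ (ball_subset_closedBall hζ)
  obtain ⟨φ, hφ, g, hg, hconv⟩ := exists_subseq_tendstoLocallyUniformlyOn_of_bounded
    isOpen_ball (fun n => (hhd n).differentiableOn) hb
  refine ⟨fun n => F (φ n), fun n => z (φ n), fun n => ρ (φ n), g, fun n => hF _, fun n => hρ _,
    hz.comp hφ.tendsto_atTop, hρ0.comp hφ.tendsto_atTop, hg, hconv, ?_⟩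
  have h0 : (0 : ℂ) ∈ ball (0 : ℂ) (m / 16) := mem_ball_self hpos
  have h1 := ((hconv.deriv (.of_forall fun n => (hhd _).differentiableOn) isOpen_ball).tendsto_at
    h0).norm
  have h2 := ((hconv.tendsto_at h0).norm.const_add 1).pow 2
  refine tendsto_nhds_unique h1 (h2.congr fun n => ?_)
  exact (hd0' (φ n)).symm

open Metric Set in
theorem exists_repelling_fixed_point_of_tendsto {F : ℕ → ℂ → ℂ} {z : ℕ → ℂ} {ρ : ℕ → ℝ}
    {f g : ℂ → ℂ} {w₀ ζ₀ : ℂ} {U : Set ℂ} (hU : IsOpen U) (hF : ∀ n, Differentiable ℂ (F n))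
    (hρ : ∀ n, 0 < ρ n) (hz : Tendsto z atTop (𝓝 w₀)) (hρ0 : Tendsto ρ atTop (𝓝 0))
    (hg : DifferentiableOn ℂ g U)
    (hconv : TendstoLocallyUniformlyOn (fun n ζ => F n (z n + ρ n * ζ)) g atTop U)
    (hf : Differentiable ℂ f) (hζ₀ : ζ₀ ∈ U) (hroot : f (g ζ₀) = w₀)
    (hsimple : deriv f (g ζ₀) ≠ 0) (hgd : deriv g ζ₀ ≠ 0) {ε : ℝ} (hε : 0 < ε) :
    ∃ n, ∃ w ∈ ball w₀ ε, f (F n w) = w ∧ 1 < ‖deriv (f ∘ F n) w‖ := by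
  set k : ℕ → ℂ → ℂ := fun n ζ => f (F n (z n + ρ n * ζ)) with hk
  have hkd : ∀ n, Differentiable ℂ (k n) := by
    intro n
    exact hf.comp ((hF n).comp (by fun_prop))
  have hfg : DifferentiableOn ℂ (fun ζ => f (g ζ)) U := hf.comp_differentiableOn hg
  have hconv' := (tendstoLocallyUniformlyOn_iff_tendsto_nhds hg.continuousOn).1 hconv
  have hkconv : TendstoLocallyUniformlyOn k (fun ζ => f (g ζ)) atTop U :=
    (tendstoLocallyUniformlyOn_iff_tendsto_nhds hfg.continuousOn).2 fun x hx =>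
      (hf.continuous.tendsto _).comp (hconv' x hx)
  have hlin : ∀ x, Tendsto (fun p : ℕ × ℂ => z p.1 + ρ p.1 * p.2) (atTop ×ˢ 𝓝[U] x) (𝓝 w₀) := by
    intro x
    have h1 : Tendsto (fun p : ℕ × ℂ => (ρ p.1 : ℂ)) (atTop ×ˢ 𝓝[U] x) (𝓝 ((0 : ℝ) : ℂ)) :=
      ((Complex.continuous_ofReal.tendsto 0).comp hρ0).comp tendsto_fst
    have h2 : Tendsto (fun p : ℕ × ℂ => p.2) (atTop ×ˢ 𝓝[U] x) (𝓝 x) :=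
      tendsto_snd.mono_right nhdsWithin_le_nhds
    simpa using (hz.comp tendsto_fst).add (h1.mul h2)
  have hdconv : TendstoLocallyUniformlyOn (fun n ζ => k n ζ - (z n + ρ n * ζ))
      (fun ζ => f (g ζ) - w₀) atTop U :=
    (tendstoLocallyUniformlyOn_iff_tendsto_nhds
      (hfg.continuousOn.sub continuousOn_const)).2 fun x hx =>
      ((tendstoLocallyUniformlyOn_iff_tendsto_nhds hfg.continuousOn).1 hkconv x hx).sub (hlin x)
  have hder : deriv (fun ζ => f (g ζ)) ζ₀ ≠ 0 := by
    have h1 : HasDerivAt g (deriv g ζ₀) ζ₀ :=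
      (hg.differentiableAt (hU.mem_nhds hζ₀)).hasDerivAt
    have h2 := ((hf (g ζ₀)).hasDerivAt.comp ζ₀ h1).deriv
    rw [Function.comp_def] at h2
    rw [h2]
    exact mul_ne_zero hsimple hgd
  set b : ℝ := ‖deriv (fun ζ => f (g ζ)) ζ₀‖ with hb
  have hb0 : 0 < b := norm_pos_iff.2 hder
  have hkderiv := (tendstoLocallyUniformlyOn_iff_tendsto_nhds
    ((hfg.deriv hU).continuousOn)).1
      (hkconv.deriv (.of_forall fun n => (hkd n).differentiableOn) hU) ζ₀ hζ₀
  have hev1 : ∀ᶠ p : ℕ × ℂ in atTop ×ˢ 𝓝[U] ζ₀, b / 2 < ‖deriv (k p.1) p.2‖ :=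
    hkderiv.norm.eventually_const_lt (half_lt_self hb0)
  have hev2 : ∀ᶠ p : ℕ × ℂ in atTop ×ˢ 𝓝[U] ζ₀, z p.1 + ρ p.1 * p.2 ∈ ball w₀ ε :=
    hlin ζ₀ (ball_mem_nhds _ hε)
  rw [hU.nhdsWithin_eq hζ₀] at hev1 hev2
  obtain ⟨p, hp, q, hq, hpq⟩ := eventually_prod_iff.1 (hev1.and hev2)
  obtain ⟨δ, hδ, hδq⟩ := Metric.eventually_nhds_iff_ball.1 hq
  have hne : ¬ ∀ᶠ ζ in 𝓝 ζ₀, f (g ζ) - w₀ = 0 := by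
    intro h
    have h1 : (fun ζ => f (g ζ)) =ᶠ[𝓝 ζ₀] fun _ => w₀ := h.mono fun ζ hζ => sub_eq_zero.1 hζ
    rw [h1.deriv_eq] at hder
    simp at hder
  have hzero := eventually_exists_zero_of_tendstoLocallyUniformlyOn hU
    (.of_forall fun n => ((hkd n).sub (by fun_prop)).differentiableOn) hdconv hζ₀
    (by rw [hroot, sub_self]) hne hδ
  obtain ⟨n, ⟨ζ, ⟨hζδ, -⟩, hζ⟩, hpn, hρb⟩ :=
    (hzero.and (hp.and (hρ0.eventually_lt_const (half_pos hb0)))).exists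
  obtain ⟨h1, h2⟩ := hpq hpn (hδq ζ hζδ)
  refine ⟨n, z n + ρ n * ζ, h2, sub_eq_zero.1 hζ, ?_⟩
  have h3 : deriv (k n) ζ = deriv (f ∘ F n) (z n + ρ n * ζ) * ρ n := by
    have h4 : HasDerivAt (fun ζ : ℂ => z n + ρ n * ζ) (ρ n : ℂ) ζ := by
      simpa using ((hasDerivAt_id ζ).const_mul (ρ n : ℂ)).const_add (z n)
    exact ((hf.comp (hF n) _).hasDerivAt.comp ζ h4).deriv
  rw [h3, norm_mul, Complex.norm_real, Real.norm_of_nonneg (hρ n).le] at h1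
  by_contra! hle
  have := mul_le_mul_of_nonneg_right hle (hρ n).le
  linarith

/-- If `𝓕` is a family of entire functions, `w₀ ∈ J(𝓕)`, and `f`
is an entire function such that `f(z) = w₀` has infinitely many simple roots,
then there exist `wₙ → w₀` and `fₙ ∈ 𝓕` such that each `wₙ` is a repelling
fixed point of `f ∘ fₙ`. -/
theorem repelling_fixed_points_of_simple_roots (𝓕 : Set (ℂ → ℂ))
    (hent : ∀ g ∈ 𝓕, Differentiable ℂ g)
    (w₀ : ℂ) (hw₀ : w₀ ∈ juliaLike 𝓕 Set.univ)
    (f : ℂ → ℂ) (hf : Differentiable ℂ f)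
    (hroots : {z : ℂ | f z = w₀ ∧ deriv f z ≠ 0}.Infinite) :
    ∃ (w : ℕ → ℂ) (g : ℕ → ℂ → ℂ), (∀ n, g n ∈ 𝓕) ∧
      Tendsto w atTop (𝓝 w₀) ∧
      ∀ n, (f ∘ g n) (w n) = w n ∧ 1 < ‖deriv (f ∘ g n) (w n)‖ := by
  have hnot : ¬ IsNormalAt 𝓕 Set.univ w₀ := fun h => hw₀.2 ⟨Set.mem_univ _, h⟩
  let a : Fin 6 → ℂ := fun i => hroots.natEmbedding _ i
  have ha : Function.Injective a := fun i j h =>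
    Fin.ext ((hroots.natEmbedding _).injective (Subtype.ext h))
  have hmem : ∀ i, f (a i) = w₀ ∧ deriv f (a i) ≠ 0 := fun i => (hroots.natEmbedding _ i).2
  obtain ⟨R, hR, hsimple⟩ := exists_radius_forall_exists_simple_root ha
  obtain ⟨m, hm⟩ := exists_nat_gt (16 * R)
  have hm0 : 0 < m := by
    have : (0 : ℝ) < m := by linarith
    exact_mod_cast this
  obtain ⟨F, z, ρ, g, hF, hρ, hz, hρ0, hg, hconv, hg0⟩ :=
    exists_rescaled_limit_of_not_isNormalAt hent hnot hm0
  obtain ⟨j, ζ₀, hζ₀, hgj, hgd⟩ := hsimple (m / 16) (by linarith) g hg hg0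
  have hex : ∀ n : ℕ, ∃ i, ∃ w ∈ Metric.ball w₀ (1 / ((n : ℝ) + 1)),
      f (F i w) = w ∧ 1 < ‖deriv (f ∘ F i) w‖ := fun n =>
    exists_repelling_fixed_point_of_tendsto Metric.isOpen_ball (fun i => hent _ (hF i)) hρ hz hρ0 hg
      hconv hf hζ₀ (by rw [hgj]; exact (hmem j).1) (by rw [hgj]; exact (hmem j).2) hgd
      Nat.one_div_pos_of_nat
  choose i w hw hfix hrep using hex
  refine ⟨w, fun n => F (i n), fun n => hF _, ?_, fun n => ⟨hfix n, hrep n⟩⟩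
  rw [tendsto_iff_dist_tendsto_zero]
  exact squeeze_zero (fun _ => dist_nonneg) (fun n => (Metric.mem_ball.1 (hw n)).le)
    tendsto_one_div_add_atTop_nhds_zero_nat
end

section
/- Let D ⊆ ℂ be a domain and 𝓕 a family of holomorphic functions on D with E(𝓕) ≠ ∅. Then for every z ∈ ℂ \ E(𝓕), the Julia like set satisfies J(𝓕) ⊆ closure of O⁻_𝓕(z). -/
open Filter Topology

/-- The backward orbit of `z` under the family `𝓕` acting on the domain `D`. -/
def backwardOrbit (𝓕 : Set (ℂ → ℂ)) (D : Set ℂ) (z : ℂ) : Set ℂ :=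
  {w ∈ D | ∃ f ∈ 𝓕, f w = z}

/-- The exceptional set of the family `𝓕`: points with finite backward orbit. -/
def exceptionalSet (𝓕 : Set (ℂ → ℂ)) (D : Set ℂ) : Set ℂ :=
  {z : ℂ | (backwardOrbit 𝓕 D z).Finite}

section Normality

open Metric Set

/-- A nonvanishing holomorphic function on a disc has a holomorphic logarithm. -/
theorem exists_log_on_ball {c : ℂ} {R : ℝ} {f : ℂ → ℂ} (hR : 0 < R)
    (hf : DifferentiableOn ℂ f (ball c R)) (h0 : ∀ z ∈ ball c R, f z ≠ 0) :
    ∃ L : ℂ → ℂ, DifferentiableOn ℂ L (ball c R) ∧ L c = Complex.log (f c) ∧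
      ∀ z ∈ ball c R, Complex.exp (L z) = f z := by
  have hc : c ∈ ball c R := mem_ball_self hR
  have hd : DifferentiableOn ℂ (fun z => deriv f z / f z) (ball c R) :=
    (hf.deriv isOpen_ball).div hf h0
  obtain ⟨L, hLc, hL⟩ := hd.isExactOn_ball.with_val_at c (Complex.log (f c))
  have hf' : ∀ z ∈ ball c R, HasDerivAt f (deriv f z) z := fun z hz =>
    (hf.differentiableAt (isOpen_ball.mem_nhds hz)).hasDerivAt
  refine ⟨L, fun z hz => (hL z hz).differentiableAt.differentiableWithinAt, hLc, ?_⟩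
  have hder : ∀ z ∈ ball c R, HasDerivAt (fun z => f z * Complex.exp (-L z)) 0 z := by
    intro z hz
    have := (hf' z hz).mul (hL z hz).fun_neg.cexp
    refine this.congr_deriv ?_
    have := h0 z hz
    field_simp
    ring
  intro z hz
  have hconst := isOpen_ball.is_const_of_deriv_eq_zero (convex_ball c R).isPreconnected
    (fun z hz => (hder z hz).differentiableAt.differentiableWithinAt)
    (fun z hz => (hder z hz).deriv) hz hc
  simp only [hLc, Complex.exp_neg, Complex.exp_log (h0 c hc), mul_inv_cancel₀ (h0 c hc)] at hconst
  rw [← div_eq_mul_inv, div_eq_one_iff_eq (Complex.exp_ne_zero _)] at hconst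
  exact hconst.symm

/-- A form of Bloch's theorem: if the image of a disc contains no disc of radius `ρ`, then the
derivative at the center is bounded. -/
theorem norm_deriv_mul_le_of_not_ball_subset_image {c : ℂ} {R r ρ : ℝ} {g : ℂ → ℂ} (hr : 0 < r)
    (hrR : r < R) (hρ : 0 < ρ) (hg : DifferentiableOn ℂ g (ball c R))
    (him : ∀ w, ¬ ball w ρ ⊆ g '' ball c R) : ‖deriv g c‖ * r ≤ 48 * ρ := by
  by_contra! hlt
  have hsub : closedBall c r ⊆ ball c R := closedBall_subset_ball hrR
  have hg' : DifferentiableOn ℂ (deriv g) (ball c R) := hg.deriv isOpen_ball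
  have hcont : ContinuousOn (fun z => ‖deriv g z‖ * (r - dist z c)) (closedBall c r) :=
    (hg'.continuousOn.mono hsub).norm.mul (by fun_prop)
  obtain ⟨p, hp, hmax⟩ := (isCompact_closedBall c r).exists_isMaxOn
    ⟨c, mem_closedBall_self hr.le⟩ hcont
  have hm : 48 * ρ < ‖deriv g p‖ * (r - dist p c) := by
    refine hlt.trans_le ?_
    simpa using hmax (mem_closedBall_self hr.le)
  have hpr : dist p c ≤ r := hp
  have hspos : 0 < r - dist p c := by
    rcases (sub_nonneg.2 hpr).eq_or_lt with h | h
    · rw [← h] at hm; linarith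
    · exact h
  set A := ‖deriv g p‖ with hA
  have hApos : 0 < A := by
    by_contra! h
    nlinarith
  obtain ⟨t, ht⟩ : ∃ t, t = (r - dist p c) / 2 := ⟨_, rfl⟩
  have htpos : 0 < t := by linarith
  have hball : ball p t ⊆ closedBall c r := by
    intro z hz
    have h1 := dist_triangle z p c
    rw [mem_ball] at hz
    rw [mem_closedBall]
    linarith
  have hbd : ∀ z ∈ ball p t, ‖deriv g z‖ ≤ 2 * A := by
    intro z hz
    have h1 := dist_triangle z p c
    have h2 : ‖deriv g z‖ * (r - dist z c) ≤ A * (r - dist p c) := hmax (hball hz)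
    rw [mem_ball] at hz
    have h3 : t ≤ r - dist z c := by linarith
    have h4 : ‖deriv g z‖ * t ≤ 2 * A * t := by
      calc ‖deriv g z‖ * t ≤ ‖deriv g z‖ * (r - dist z c) := by gcongr
        _ ≤ A * (r - dist p c) := h2
        _ = 2 * A * t := by rw [ht]; ring
    exact le_of_mul_le_mul_right h4 htpos
  have hmaps : MapsTo (deriv g) (ball p t) (closedBall (deriv g p) (3 * A)) := by
    intro z hz
    rw [mem_closedBall, dist_eq_norm]
    have := norm_sub_le (deriv g z) (deriv g p)
    linarith [hbd z hz]
  have hclose : ∀ z ∈ closedBall p (t / 6), ‖deriv g z - deriv g p‖ ≤ A / 2 := by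
    intro z hz
    have hz' : z ∈ ball p t := closedBall_subset_ball (by linarith) hz
    have h1 := Complex.dist_le_div_mul_dist_of_mapsTo_ball
      (hg'.mono (hball.trans hsub)) hmaps hz'
    rw [mem_closedBall] at hz
    rw [← dist_eq_norm]
    calc _ ≤ _ := h1
      _ ≤ 3 * A / t * (t / 6) := by gcongr
      _ = A / 2 := by field_simp; norm_num
  have hsub6 : closedBall p (t / 6) ⊆ ball c R :=
    (closedBall_subset_ball (by linarith)).trans (hball.trans hsub)
  have hlow : ∀ z ∈ closedBall p (t / 6), A / 2 * ‖z - p‖ ≤ ‖g z - g p‖ := by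
    intro z hz
    have hD : ∀ x ∈ closedBall p (t / 6),
        HasDerivAt (fun z => g z - deriv g p * z) (deriv g x - deriv g p) x := by
      intro x hx
      have := ((hg.differentiableAt (isOpen_ball.mem_nhds (hsub6 hx))).hasDerivAt).fun_sub
        ((hasDerivAt_id x).const_mul (deriv g p))
      simpa using this
    have h1 := (convex_closedBall p (t / 6)).norm_image_sub_le_of_norm_deriv_le
      (fun x hx => (hD x hx).differentiableAt)
      (fun x hx => by rw [(hD x hx).deriv]; exact hclose x hx)
      (mem_closedBall_self (by linarith)) hz
    have h2 : deriv g p * (z - p) =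
        (g z - g p) - ((g z - deriv g p * z) - (g p - deriv g p * p)) := by ring
    have h3 : A * ‖z - p‖ ≤ ‖g z - g p‖ + A / 2 * ‖z - p‖ := by
      rw [hA, ← norm_mul, h2]
      exact (norm_sub_le _ _).trans (by gcongr)
    linarith
  have hdc : DiffContOnCl ℂ g (ball p (t / 6)) :=
    (hg.mono hsub6).diffContOnCl_ball subset_rfl
  have himg := hdc.ball_subset_image_closedBall (ε := A * t / 12) (by linarith)
    (fun z hz => by
      have h1 := hlow z (sphere_subset_closedBall hz)
      rw [mem_sphere, dist_eq_norm] at hz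
      rw [hz] at h1
      linarith)
    (by
      have hev : ∀ᶠ z in 𝓝[≠] p, g z ≠ g p := by
        filter_upwards [self_mem_nhdsWithin,
          nhdsWithin_le_nhds (closedBall_mem_nhds p (by linarith : 0 < t / 6))] with z hz hz'
        have h1 := hlow z hz'
        have h2 : 0 < ‖z - p‖ := norm_pos_iff.2 (sub_ne_zero.2 hz)
        intro h
        rw [h, sub_self, norm_zero] at h1
        nlinarith
      exact hev.frequently.filter_mono nhdsWithin_le_nhds)
  refine him (g p) ((ball_subset_ball ?_).trans (himg.trans (image_mono hsub6)))
  rw [ht]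
  linarith

theorem exists_cosh_eq_odd_mem_ball (w : ℂ) :
    ∃ v ∈ ball w 6, ∃ n : ℤ, Complex.cosh v = 2 * n + 1 := by
  have hpos : ∀ x : ℝ, 0 ≤ x → ∃ y : ℝ, |y - x| ≤ 2 ∧ ∃ n : ℤ, Real.cosh y = 2 * n + 1 := by
    intro x hx
    have hc2 : 3 ≤ Real.cosh 2 := by
      have := Real.cosh_sq 1
      have h2 := Real.cosh_two_mul 1
      have h3 : 1 ≤ Real.sinh 1 := Real.self_le_sinh_iff.2 zero_le_one
      rw [mul_one] at h2
      nlinarith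
    have hstep : Real.cosh x + 2 ≤ Real.cosh (x + 2) := by
      rw [Real.cosh_add]
      have h1 := Real.one_le_cosh x
      have h2 : 0 ≤ Real.sinh x := Real.sinh_nonneg_iff.2 hx
      have h3 : 0 ≤ Real.sinh 2 := Real.sinh_nonneg_iff.2 (by norm_num)
      nlinarith [mul_nonneg h2 h3]
    obtain ⟨n, hn⟩ : ∃ n : ℤ, n = ⌈(Real.cosh x - 1) / 2⌉ := ⟨_, rfl⟩
    have h1 : (Real.cosh x - 1) / 2 ≤ n := hn ▸ Int.le_ceil _
    have h2 : (n : ℝ) < (Real.cosh x - 1) / 2 + 1 := hn ▸ Int.ceil_lt_add_one _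
    obtain ⟨y, hy, hy'⟩ := intermediate_value_Icc (by linarith : x ≤ x + 2)
      Real.continuous_cosh.continuousOn
      (show (2 * n + 1 : ℝ) ∈ Icc (Real.cosh x) (Real.cosh (x + 2)) from
        ⟨by linarith, by linarith⟩)
    exact ⟨y, by rw [abs_le]; constructor <;> linarith [hy.1, hy.2], n, hy'⟩
  obtain ⟨y, hy, n, hn⟩ : ∃ y : ℝ, |y - w.re| ≤ 2 ∧ ∃ n : ℤ, Real.cosh y = 2 * n + 1 := by
    rcases le_total 0 w.re with h | h
    · exact hpos _ h
    · obtain ⟨y, hy, n, hn⟩ := hpos (-w.re) (by linarith)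
      refine ⟨-y, ?_, n, by rw [Real.cosh_neg, hn]⟩
      rw [← abs_neg]
      convert hy using 2
      ring
  obtain ⟨m, hm⟩ : ∃ m : ℤ, m = round (w.im / (2 * Real.pi)) := ⟨_, rfl⟩
  have hpi := Real.pi_pos
  have hm' : |m * (2 * Real.pi) - w.im| ≤ Real.pi := by
    have h1 : |w.im / (2 * Real.pi) - m| ≤ 1 / 2 := hm ▸ abs_sub_round _
    have h2 : m * (2 * Real.pi) - w.im = -((w.im / (2 * Real.pi) - m) * (2 * Real.pi)) := by
      field_simp; ring
    rw [h2, abs_neg, abs_mul, abs_of_pos (by linarith : 0 < 2 * Real.pi)]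
    nlinarith
  refine ⟨y + (m * (2 * Real.pi) : ℂ) * Complex.I, ?_, n, ?_⟩
  · rw [mem_ball, dist_eq_norm]
    refine (Complex.norm_le_abs_re_add_abs_im _).trans_lt ?_
    have e1 : (y + (m * (2 * Real.pi) : ℂ) * Complex.I - w).re = y - w.re := by simp
    have e2 : (y + (m * (2 * Real.pi) : ℂ) * Complex.I - w).im = m * (2 * Real.pi) - w.im := by
      simp
    rw [e1, e2]
    linarith [Real.pi_lt_four]
  · rw [Complex.cosh_add, Complex.cosh_mul_I, Complex.sinh_mul_I, Complex.cos_int_mul_two_pi]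
    have : Complex.sin (m * (2 * Real.pi)) = 0 := by
      rw [Complex.sin_eq_zero_iff]
      exact ⟨2 * m, by push_cast; ring⟩
    rw [this, ← Complex.ofReal_cosh, hn]
    push_cast
    ring

theorem norm_log_le_abs_log_norm_add_pi (z : ℂ) :
    ‖Complex.log z‖ ≤ |Real.log ‖z‖| + Real.pi := by
  refine (Complex.norm_le_abs_re_add_abs_im _).trans ?_
  rw [Complex.log_re, Complex.log_im]
  gcongr
  exact Complex.abs_arg_le_pi z

theorem schottky_of_half_le (M : ℝ) : ∃ C : ℝ, ∀ (c : ℂ) (R : ℝ) (f : ℂ → ℂ), 0 < R →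
    DifferentiableOn ℂ f (ball c R) → (∀ z ∈ ball c R, f z ≠ 0) → (∀ z ∈ ball c R, f z ≠ 1) →
    1 / 2 ≤ ‖f c‖ → ‖f c‖ ≤ M → ∀ z ∈ closedBall c (R / 2), ‖f z‖ ≤ C := by
  obtain ⟨a, ha⟩ : ∃ a, a = |Real.log (1 / 2)| + |Real.log M| + Real.pi := ⟨_, rfl⟩
  have hpi := Real.pi_pos
  have hapos : 0 < a := by rw [ha]; positivity
  refine ⟨Real.exp (Real.pi * Real.exp (Real.log (2 * a + 1) + Real.pi + 576)), ?_⟩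
  intro c R f hR hf h0 h1 hlow hup
  have hc : c ∈ ball c R := mem_ball_self hR
  obtain ⟨L, hLd, hLc, hL⟩ := exists_log_on_ball hR hf.fun_neg (fun z hz => neg_ne_zero.2 (h0 z hz))
  have hpiI : (Real.pi : ℂ) * Complex.I ≠ 0 :=
    mul_ne_zero (by exact_mod_cast hpi.ne') Complex.I_ne_zero
  obtain ⟨A, hA⟩ : ∃ A : ℂ → ℂ, A = fun z => L z / (Real.pi * Complex.I) := ⟨_, rfl⟩
  have hAL : ∀ z, Real.pi * Complex.I * A z = L z := by
    intro z; rw [hA]; field_simp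
  have hAd : DifferentiableOn ℂ A (ball c R) := hA ▸ hLd.div_const _
  have hAodd : ∀ z ∈ ball c R, ∀ n : ℤ, A z ≠ 2 * n + 1 := by
    intro z hz n hn
    have e1 := hL z hz
    rw [← hAL z, hn, show Real.pi * Complex.I * (2 * n + 1) =
      n * (2 * Real.pi * Complex.I) + Real.pi * Complex.I by ring, Complex.exp_add,
      Complex.exp_int_mul_two_pi_mul_I, Complex.exp_pi_mul_I, one_mul] at e1
    exact h1 z hz (neg_injective e1).symm
  have hAc : ‖A c‖ ≤ a := by
    have e1 : ‖L c‖ ≤ a := by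
      rw [hLc, ha]
      refine (norm_log_le_abs_log_norm_add_pi _).trans ?_
      rw [norm_neg]
      gcongr
      have u1 := Real.log_le_log (by norm_num) hlow
      have u2 := Real.log_le_log (by linarith) hup
      rw [abs_le]
      constructor
      · linarith [neg_abs_le (Real.log (1 / 2)), abs_nonneg (Real.log M)]
      · linarith [le_abs_self (Real.log M), abs_nonneg (Real.log (1 / 2))]
    rw [← hAL c, norm_mul, norm_mul, Complex.norm_I, mul_one, Complex.norm_real,
      Real.norm_of_nonneg hpi.le] at e1
    nlinarith [norm_nonneg (A c), Real.pi_gt_three]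
  have hQ : ∀ z ∈ ball c R, A z ^ 2 - 1 ≠ 0 := by
    intro z hz h
    have h' : (A z - 1) * (A z + 1) = 0 := by rw [← h]; ring
    rcases mul_eq_zero.1 h' with h | h
    · exact hAodd z hz 0 (by push_cast; linear_combination h)
    · exact hAodd z hz (-1) (by push_cast; linear_combination h)
  obtain ⟨S, hSd, -, hS⟩ := exists_log_on_ball hR ((hAd.fun_pow 2).sub_const 1) hQ
  obtain ⟨s, hs⟩ : ∃ s : ℂ → ℂ, s = fun z => Complex.exp (S z / 2) := ⟨_, rfl⟩
  have hsd : DifferentiableOn ℂ s (ball c R) := hs ▸ (hSd.div_const 2).cexp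
  have hs2 : ∀ z ∈ ball c R, s z ^ 2 = A z ^ 2 - 1 := by
    intro z hz
    rw [hs, ← hS z hz, ← Complex.exp_nat_mul]
    congr 1
    push_cast
    ring
  have hprod : ∀ z ∈ ball c R, (A z + s z) * (A z - s z) = 1 := by
    intro z hz
    linear_combination -hs2 z hz
  have hP : ∀ z ∈ ball c R, A z + s z ≠ 0 := by
    intro z hz h
    have := hprod z hz
    rw [h, zero_mul] at this
    exact zero_ne_one this
  obtain ⟨H, hHd, hHc, hH⟩ := exists_log_on_ball hR (hAd.fun_add hsd) hP
  have hcosh : ∀ z ∈ ball c R, Complex.cosh (H z) = A z := by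
    intro z hz
    have e : Complex.exp (-H z) = A z - s z := by
      rw [Complex.exp_neg, hH z hz]
      exact inv_eq_of_mul_eq_one_right (hprod z hz)
    rw [Complex.cosh, hH z hz, e]
    ring
  have hHcb : ‖H c‖ ≤ Real.log (2 * a + 1) + Real.pi := by
    have hsc : ‖s c‖ ≤ a + 1 := by
      have e1 : ‖s c‖ ^ 2 ≤ a ^ 2 + 1 := by
        rw [← norm_pow, hs2 c hc]
        refine (norm_sub_le _ _).trans ?_
        rw [norm_pow, norm_one]
        gcongr
      nlinarith [norm_nonneg (s c)]
    have e1 : ‖A c + s c‖ ≤ 2 * a + 1 := (norm_add_le _ _).trans (by linarith)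
    have e2 : ‖A c - s c‖ ≤ 2 * a + 1 := (norm_sub_le _ _).trans (by linarith)
    have e3 : ‖A c + s c‖ * ‖A c - s c‖ = 1 := by
      rw [← norm_mul, hprod c hc, norm_one]
    have e4 : 0 < ‖A c + s c‖ := norm_pos_iff.2 (hP c hc)
    have e5 : 0 < ‖A c - s c‖ := by
      by_contra! h
      nlinarith
    have e6 : Real.log ‖A c + s c‖ = -Real.log ‖A c - s c‖ := by
      have := Real.log_mul e4.ne' e5.ne'
      rw [e3, Real.log_one] at this
      linarith
    have e7 := Real.log_le_log e4 e1
    have e8 := Real.log_le_log e5 e2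
    rw [hHc]
    refine (norm_log_le_abs_log_norm_add_pi _).trans ?_
    gcongr
    rw [abs_le]
    constructor <;> linarith
  have hsub : closedBall c (R / 2) ⊆ ball c R := closedBall_subset_ball (by linarith)
  have hH' : ∀ z ∈ closedBall c (R / 2), ‖deriv H z‖ ≤ 1152 / R := by
    intro z hz
    have hzsub : ball z (R / 2) ⊆ ball c R := ball_subset_ball' (by
      rw [mem_closedBall] at hz
      linarith)
    have e := norm_deriv_mul_le_of_not_ball_subset_image (c := z) (R := R / 2) (r := R / 4)
      (ρ := 6) (g := H) (by linarith) (by linarith) (by norm_num) (hHd.mono hzsub) (by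
        intro w hw
        obtain ⟨v, hv, n, hn⟩ := exists_cosh_eq_odd_mem_ball w
        obtain ⟨x, hx, rfl⟩ := hw hv
        exact hAodd x (hzsub hx) n (by rw [← hcosh x (hzsub hx), hn]))
    rw [le_div_iff₀ hR]
    linarith
  intro z hz
  have hHz : ‖H z‖ ≤ Real.log (2 * a + 1) + Real.pi + 576 := by
    have e1 := (convex_closedBall c (R / 2)).norm_image_sub_le_of_norm_deriv_le
      (fun x hx => hHd.differentiableAt (isOpen_ball.mem_nhds (hsub hx))) hH'
      (mem_closedBall_self (by linarith)) hz
    have e2 : 1152 / R * ‖z - c‖ ≤ 576 := by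
      rw [mem_closedBall, dist_eq_norm] at hz
      calc 1152 / R * ‖z - c‖ ≤ 1152 / R * (R / 2) := by gcongr
        _ = 576 := by field_simp; norm_num
    have e3 := norm_add_le (H z - H c) (H c)
    rw [sub_add_cancel] at e3
    linarith
  have hAz : ‖A z‖ ≤ Real.exp ‖H z‖ := by
    rw [← hcosh z (hsub hz), Complex.cosh, norm_div]
    have e1 := norm_add_le (Complex.exp (H z)) (Complex.exp (-H z))
    have e2 := Complex.norm_exp_le_exp_norm (H z)
    have e3 := Complex.norm_exp_le_exp_norm (-H z)
    rw [norm_neg] at e3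
    rw [Complex.norm_ofNat]
    linarith
  rw [← norm_neg, ← hL z (hsub hz), ← hAL z]
  refine (Complex.norm_exp_le_exp_norm _).trans ?_
  rw [norm_mul, norm_mul, Complex.norm_I, mul_one, Complex.norm_real,
    Real.norm_of_nonneg hpi.le]
  gcongr
  exact hAz.trans (Real.exp_le_exp.2 hHz)

/-- Schottky's theorem: a holomorphic function on a disc that omits `0` and `1` is bounded on the
concentric disc of half the radius, in terms of a bound at the center only. -/
theorem schottky (M : ℝ) : ∃ C : ℝ, ∀ (c : ℂ) (R : ℝ) (f : ℂ → ℂ), 0 < R →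
    DifferentiableOn ℂ f (ball c R) → (∀ z ∈ ball c R, f z ≠ 0) → (∀ z ∈ ball c R, f z ≠ 1) →
    ‖f c‖ ≤ M → ∀ z ∈ closedBall c (R / 2), ‖f z‖ ≤ C := by
  obtain ⟨C, hC⟩ := schottky_of_half_le (M + 1)
  refine ⟨C + 1, fun c R f hR hf h0 h1 hM z hz => ?_⟩
  rcases le_or_gt (1 / 2) ‖f c‖ with h | h
  · linarith [hC c R f hR hf h0 h1 h (by linarith) z hz]
  · have e1 := norm_sub_norm_le 1 (f c)
    have e2 := norm_sub_le 1 (f c)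
    rw [norm_one] at e1 e2
    have e3 := hC c R (fun z => 1 - f z) hR (hf.const_sub 1)
      (fun z hz => sub_ne_zero.2 (h1 z hz).symm)
      (fun z hz e => h0 z hz (by linear_combination -e)) (by linarith) (by linarith) z hz
    have e4 := norm_sub_le 1 (1 - f z)
    rw [sub_sub_cancel, norm_one] at e4
    linarith

theorem schottky_on_sphere (M : ℝ) : ∃ C : ℝ, ∀ (w : ℂ) (R : ℝ) (h : ℂ → ℂ), 0 < R →
    DifferentiableOn ℂ h (ball w R) → (∀ z ∈ ball w R, h z ≠ 0) →
    (∀ z ∈ ball w R, z ≠ w → h z ≠ 1) →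
    ∀ z₁ ∈ sphere w (R * Real.exp (-8)), ∀ z₂ ∈ sphere w (R * Real.exp (-8)),
      ‖h z₁‖ ≤ M → ‖h z₂‖ ≤ C := by
  obtain ⟨C, hC⟩ := schottky M
  refine ⟨C, fun w R h hR hh h0 h1 z₁ hz₁ z₂ hz₂ hM => ?_⟩
  have hρ : 0 < R * Real.exp (-8) := by positivity
  rw [mem_sphere, dist_eq_norm] at hz₁ hz₂
  have hne₁ : z₁ - w ≠ 0 := norm_pos_iff.1 (hz₁ ▸ hρ)
  have hne₂ : z₂ - w ≠ 0 := norm_pos_iff.1 (hz₂ ▸ hρ)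
  obtain ⟨ζ, hζ⟩ : ∃ ζ, ζ = Complex.log (z₁ - w) := ⟨_, rfl⟩
  have hexp : ∀ x ∈ ball ζ 8, w + Complex.exp x ∈ ball w R := by
    intro x hx
    rw [mem_ball, dist_eq_norm] at hx
    rw [mem_ball, dist_eq_norm, add_sub_cancel_left, Complex.norm_exp]
    have e1 := (Complex.abs_re_le_norm (x - ζ)).trans_lt hx
    have e2 : ζ.re = Real.log R - 8 := by
      rw [hζ, Complex.log_re, hz₁, Real.log_mul hR.ne' (Real.exp_ne_zero _), Real.log_exp]
      ring
    rw [Complex.sub_re, abs_lt, e2] at e1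
    calc Real.exp x.re < Real.exp (Real.log R) := Real.exp_lt_exp.2 (by linarith)
      _ = R := Real.exp_log hR
  have e1 : w + Complex.exp ζ = z₁ := by
    rw [hζ, Complex.exp_log hne₁]
    ring
  obtain ⟨η, hη⟩ : ∃ η, η = Complex.log ((z₂ - w) / (z₁ - w)) := ⟨_, rfl⟩
  have e2 : w + Complex.exp (ζ + η) = z₂ := by
    rw [Complex.exp_add, hη, hζ, Complex.exp_log hne₁, Complex.exp_log (div_ne_zero hne₂ hne₁),
      mul_div_cancel₀ _ hne₁]
    ring
  have e3 : ‖η‖ ≤ 4 := by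
    have := norm_log_le_abs_log_norm_add_pi ((z₂ - w) / (z₁ - w))
    rw [norm_div, hz₁, hz₂, div_self hρ.ne', Real.log_one, abs_zero, zero_add, ← hη] at this
    linarith [Real.pi_lt_four]
  have := hC ζ 8 (fun x => h (w + Complex.exp x)) (by norm_num)
    (hh.comp (by fun_prop) hexp) (fun x hx => h0 _ (hexp x hx))
    (fun x hx => h1 _ (hexp x hx) (by simp [Complex.exp_ne_zero]))
    (by rwa [e1]) (ζ + η) (by
      rw [mem_closedBall, dist_eq_norm, add_sub_cancel_left]
      linarith)
  rwa [e2] at this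

/-- Montel's theorem on a disc: a uniformly bounded sequence of holomorphic functions has a locally
uniformly convergent subsequence. -/
theorem exists_subseq_tendstoLocallyUniformlyOn_ball {w : ℂ} {r M : ℝ} (hr : 0 < r)
    {f : ℕ → ℂ → ℂ} (hf : ∀ n, DiffContOnCl ℂ (f n) (ball w r))
    (hM : ∀ n, ∀ z ∈ sphere w r, ‖f n z‖ ≤ M) :
    ∃ φ : ℕ → ℕ, StrictMono φ ∧ ∃ g : ℂ → ℂ, DifferentiableOn ℂ g (ball w r) ∧
      TendstoLocallyUniformlyOn (fun n => f (φ n)) g atTop (ball w r) := by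
  obtain ⟨a, ha⟩ : ∃ a : ℕ → ℕ → ℂ,
      a = fun n k => ((k.factorial : ℂ))⁻¹ * iteratedDeriv k (f n) w := ⟨_, rfl⟩
  have hsum : ∀ n, ∀ z ∈ ball w r, HasSum (fun k => a n k * (z - w) ^ k) (f n z) := by
    intro n z hz
    have h1 := Complex.hasSum_taylorSeries_on_ball (hf n).differentiableOn hz
    have h2 : (fun k => a n k * (z - w) ^ k) = fun k : ℕ =>
        ((k.factorial : ℂ))⁻¹ • (z - w) ^ k • iteratedDeriv k (f n) w := by
      funext k
      simp only [ha, smul_eq_mul]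
      ring
    rw [h2]
    exact h1
  have hbd : ∀ n k, ‖a n k‖ ≤ M / r ^ k := by
    intro n k
    have h1 := Complex.norm_iteratedDeriv_le_of_forall_mem_sphere_norm_le k hr (hf n) (hM n)
    have h2 : (0 : ℝ) < k.factorial := by exact_mod_cast k.factorial_pos
    rw [ha, norm_mul, norm_inv, Complex.norm_natCast, inv_mul_le_iff₀ h2]
    rwa [← mul_div_assoc]
  have hcpt : IsCompact (univ.pi fun k : ℕ => closedBall (0 : ℂ) (M / r ^ k)) :=
    isCompact_univ_pi fun k => isCompact_closedBall _ _
  obtain ⟨b, hb, φ, hφ, hlim⟩ := hcpt.isSeqCompact (x := a)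
    (fun n k _ => by simpa using hbd n k)
  rw [tendsto_pi_nhds] at hlim
  have hb' : ∀ k, ‖b k‖ ≤ M / r ^ k := fun k => by simpa using hb k (mem_univ k)
  have hlu : TendstoLocallyUniformlyOn (fun n => f (φ n)) (fun z => ∑' k, b k * (z - w) ^ k)
      atTop (ball w r) := by
    rw [tendstoLocallyUniformlyOn_iff_forall_isCompact isOpen_ball]
    intro K hK hKc
    obtain ⟨s, hs0, hsr, hKs⟩ : ∃ s, 0 ≤ s ∧ s < r ∧ K ⊆ closedBall w s := by
      rcases K.eq_empty_or_nonempty with rfl | hne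
      · exact ⟨0, le_rfl, hr, empty_subset _⟩
      · obtain ⟨p, hp, hmax⟩ := hKc.exists_isMaxOn hne
          (f := fun z => dist z w) (by fun_prop)
        exact ⟨dist p w, dist_nonneg, hK hp, fun z hz => hmax hz⟩
    have hgeo : Summable fun k : ℕ => 2 * M * (s / r) ^ k :=
      (summable_geometric_of_lt_one (by positivity) ((div_lt_one hr).2 hsr)).mul_left _
    have hdom : ∀ n k, ‖a n k - b k‖ * s ^ k ≤ 2 * M * (s / r) ^ k := by
      intro n k
      calc ‖a n k - b k‖ * s ^ k ≤ (M / r ^ k + M / r ^ k) * s ^ k := by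
            gcongr
            exact (norm_sub_le _ _).trans (add_le_add (hbd n k) (hb' k))
        _ = 2 * M * (s / r) ^ k := by rw [div_pow]; ring
    have hT : Tendsto (fun n => ∑' k, ‖a (φ n) k - b k‖ * s ^ k) atTop (𝓝 0) := by
      have := tendsto_tsum_of_dominated_convergence (𝓕 := atTop)
        (f := fun n k => ‖a (φ n) k - b k‖ * s ^ k) (g := fun _ => 0) hgeo
        (fun k => by
          have h1 := (((hlim k).sub_const (b k)).norm).mul_const (s ^ k)
          simpa using h1)
        (Eventually.of_forall fun n k => by
          rw [Real.norm_of_nonneg (by positivity)]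
          exact hdom _ k)
      simpa using this
    rw [Metric.tendstoUniformlyOn_iff]
    intro ε hε
    filter_upwards [hT.eventually_lt_const hε] with n hn z hz
    have hzs : ‖z - w‖ ≤ s := by simpa [dist_eq_norm] using hKs hz
    refine lt_of_le_of_lt ?_ hn
    have hsa := hsum (φ n) z (hK hz)
    have hsd : Summable fun k => ‖a (φ n) k - b k‖ * s ^ k :=
      Summable.of_nonneg_of_le (fun k => by positivity) (hdom _) hgeo
    have hle : ∀ k, ‖(a (φ n) k - b k) * (z - w) ^ k‖ ≤ ‖a (φ n) k - b k‖ * s ^ k := by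
      intro k
      rw [norm_mul, norm_pow]
      gcongr
    have hsdiff : Summable fun k => (a (φ n) k - b k) * (z - w) ^ k :=
      Summable.of_norm_bounded hsd hle
    have heq : f (φ n) z - ∑' k, b k * (z - w) ^ k = ∑' k, (a (φ n) k - b k) * (z - w) ^ k := by
      have hsb : Summable fun k => b k * (z - w) ^ k := by
        have := hsa.summable.sub hsdiff
        refine this.congr fun k => ?_
        ring
      rw [← hsa.tsum_eq, ← hsa.summable.tsum_sub hsb]
      exact tsum_congr fun k => by ring
    rw [dist_comm, dist_eq_norm, heq]
    exact tsum_of_norm_bounded hsd.hasSum hle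
  exact ⟨φ, hφ, _, hlu.differentiableOn
    (Eventually.of_forall fun n => (hf (φ n)).differentiableOn) isOpen_ball, hlu⟩

/-- A normality criterion: a family of holomorphic functions on `D` is normal at `w` if near `w` it
omits the value `b` and takes the value `a ≠ b` at most at `w` itself. -/
theorem isNormalAt_of_omits {𝓕 : Set (ℂ → ℂ)} {D : Set ℂ}
    (hol : ∀ f ∈ 𝓕, DifferentiableOn ℂ f D) {a b w : ℂ} (hab : a ≠ b) {R : ℝ} (hR : 0 < R)
    (hRD : ball w R ⊆ D) (hb : ∀ f ∈ 𝓕, ∀ z ∈ ball w R, f z ≠ b)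
    (ha : ∀ f ∈ 𝓕, ∀ z ∈ ball w R, z ≠ w → f z ≠ a) : IsNormalAt 𝓕 D w := by
  obtain ⟨ρ, hρ⟩ : ∃ ρ, ρ = R * Real.exp (-8) := ⟨_, rfl⟩
  have hρ0 : 0 < ρ := by rw [hρ]; positivity
  have hρR : ρ < R := by
    have : Real.exp (-8) < 1 := Real.exp_lt_one_iff.2 (by norm_num)
    rw [hρ]
    nlinarith
  have hcl : closedBall w ρ ⊆ ball w R := closedBall_subset_ball hρR
  refine ⟨ball w ρ, isOpen_ball, mem_ball_self hρ0,
    (ball_subset_closedBall.trans hcl).trans hRD, fun f hf => ?_⟩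
  have hab' : a - b ≠ 0 := sub_ne_zero.2 hab
  have hab0 : 0 < ‖a - b‖ := norm_pos_iff.2 hab'
  have hfd : ∀ n, DifferentiableOn ℂ (f n) (ball w R) := fun n => (hol _ (hf n)).mono hRD
  obtain ⟨h, hh⟩ : ∃ h : ℕ → ℂ → ℂ, h = fun n z => (f n z - b) / (a - b) := ⟨_, rfl⟩
  have hfh : ∀ n z, f n z = (a - b) * h n z + b := by
    intro n z
    rw [hh]
    field_simp
    ring
  have hhd : ∀ n, DifferentiableOn ℂ (h n) (ball w R) := by
    intro n
    rw [hh]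
    exact ((hfd n).sub_const b).div_const _
  have hh0 : ∀ n, ∀ z ∈ ball w R, h n z ≠ 0 := by
    intro n z hz h0
    refine hb _ (hf n) z hz ?_
    rw [hfh, h0]
    ring
  have hh1 : ∀ n, ∀ z ∈ ball w R, z ≠ w → h n z ≠ 1 := by
    intro n z hz hzw h1
    refine ha _ (hf n) z hz hzw ?_
    rw [hfh, h1]
    ring
  have hschottky : ∀ M : ℝ, ∃ C : ℝ, ∀ n, ∀ z₁ ∈ sphere w ρ, ∀ z₂ ∈ sphere w ρ,
      ‖h n z₁‖ ≤ M → ‖h n z₂‖ ≤ C := by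
    intro M
    obtain ⟨C, hC⟩ := schottky_on_sphere M
    rw [hρ]
    exact ⟨C, fun n => hC w R (h n) hR (hhd n) (hh0 n) (hh1 n)⟩
  have hz₀ : w + ρ ∈ sphere w ρ := by
    simp [abs_of_pos hρ0]
  by_cases hcase : ∃ M : ℝ, ∃ᶠ n in atTop, ‖h n (w + ρ)‖ ≤ M
  · obtain ⟨M, hM⟩ := hcase
    obtain ⟨φ, hφ, hφM⟩ := extraction_of_frequently_atTop hM
    obtain ⟨C, hC⟩ := hschottky M
    obtain ⟨ψ, hψ, g, hg, hlim⟩ := exists_subseq_tendstoLocallyUniformlyOn_ball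
      (w := w) (r := ρ) (M := ‖a - b‖ * C + ‖b‖) hρ0 (f := fun n => f (φ n))
      (fun n => ((hfd (φ n)).mono hcl).diffContOnCl_ball subset_rfl)
      (fun n z hz => by
        simp only [hfh]
        refine (norm_add_le _ _).trans ?_
        rw [norm_mul]
        gcongr
        exact hC (φ n) _ hz₀ z hz (hφM n))
    exact ⟨φ ∘ ψ, hφ.comp hψ, Or.inl ⟨g, hg, hlim⟩⟩
  · push Not at hcase
    refine ⟨id, strictMono_id, Or.inr fun M K hK _ => ?_⟩
    obtain ⟨N, hN⟩ : ∃ N, N = (|M| + ‖b‖ + 1) / ‖a - b‖ := ⟨_, rfl⟩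
    have hN0 : 0 < N := by rw [hN]; positivity
    obtain ⟨C, hC⟩ := hschottky N
    filter_upwards [hcase C] with n hn z hz
    have hlow : ∀ x ∈ sphere w ρ, N ≤ ‖h n x‖ := fun x hx => by
      by_contra! hlt
      exact (hn.trans_le (hC n x hx _ hz₀ hlt.le)).false
    have hinv : ‖(h n z)⁻¹‖ ≤ N⁻¹ := by
      have hd : DiffContOnCl ℂ (fun z => (h n z)⁻¹) (ball w ρ) :=
        (((hhd n).fun_inv (hh0 n)).mono hcl).diffContOnCl_ball subset_rfl
      refine Complex.norm_le_of_forall_mem_frontier_norm_le isBounded_ball hd (fun x hx => ?_)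
        (subset_closure (hK hz))
      rw [frontier_ball w hρ0.ne'] at hx
      rw [norm_inv]
      exact inv_anti₀ hN0 (hlow x hx)
    have hz' : 0 < ‖h n z‖ := norm_pos_iff.2 (hh0 n z (hcl (ball_subset_closedBall (hK hz))))
    rw [norm_inv, inv_le_inv₀ hz' hN0] at hinv
    have h1 : ‖a - b‖ * N = |M| + ‖b‖ + 1 := by
      rw [hN]
      field_simp
    have h2 : ‖a - b‖ * N ≤ ‖f n z‖ + ‖b‖ := by
      calc ‖a - b‖ * N ≤ ‖a - b‖ * ‖h n z‖ := by gcongr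
        _ = ‖f n z - b‖ := by rw [← norm_mul, hfh n z, add_sub_cancel_right]
        _ ≤ ‖f n z‖ + ‖b‖ := norm_sub_le _ _
    change M ≤ ‖f n z‖
    linarith [le_abs_self M]

end Normality

/-- If the exceptional set of `𝓕` is nonempty, then for every
`z ∉ E(𝓕)` the Julia like set is contained in the closure of the backward
orbit of `z`. -/
theorem juliaLike_subset_closure_backwardOrbit (D : Set ℂ) (hD : IsOpen D)
    (hDconn : IsConnected D) (𝓕 : Set (ℂ → ℂ))
    (hol : ∀ f ∈ 𝓕, DifferentiableOn ℂ f D)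
    (hE : (exceptionalSet 𝓕 D).Nonempty) :
    ∀ z : ℂ, z ∉ exceptionalSet 𝓕 D →
      juliaLike 𝓕 D ⊆ closure (backwardOrbit 𝓕 D z) := by
  rintro b hb w ⟨hwD, hwF⟩
  by_contra hcl
  obtain ⟨a, ha⟩ := hE
  have hab : a ≠ b := fun h => hb (h ▸ ha)
  have hfin : (backwardOrbit 𝓕 D a \ {w}).Finite := Set.Finite.sdiff ha
  have h1 : (closure (backwardOrbit 𝓕 D b))ᶜ ∈ 𝓝 w := isClosed_closure.isOpen_compl.mem_nhds hcl
  have h2 : (backwardOrbit 𝓕 D a \ {w})ᶜ ∈ 𝓝 w :=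
    hfin.isClosed.isOpen_compl.mem_nhds (by simp)
  obtain ⟨R, hR, hRsub⟩ := Metric.mem_nhds_iff.1 (inter_mem (hD.mem_nhds hwD) (inter_mem h1 h2))
  refine hwF ⟨hwD, isNormalAt_of_omits hol hab hR (fun z hz => (hRsub hz).1) ?_ ?_⟩
  · intro f hf z hz hfz
    exact (hRsub hz).2.1 (subset_closure ⟨(hRsub hz).1, f, hf, hfz⟩)
  · intro f hf z hz hzw hfz
    exact (hRsub hz).2.2 ⟨⟨(hRsub hz).1, f, hf, hfz⟩, hzw⟩
end
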